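/- arXiv:2305.03285 — 3 statements merged into one kernel-verified Lean document; each statement's English description precedes it below -/
import Mathlib

section
/- Let C be the extended quaternary quadratic residue code of length 18 and let f ∈ Harm_3 (a harmonic function of degree 3 on subsets of {1,…,18}) be fixed by the action of every element of Aut(C). Then there exists a real number c_f such that the harmonic weight enumerator w_{C,f}(x,y) = Σ_{c ∈ C} f̃(supp(c)) x^{18−wt(c)} y^{wt(c)} equals c_f · (−1224 x^{12} y^6 + 3672 x^{10} y^8 − 14688 x^9 y^9 + 3672 x^8 y^{10} + 51408 x^7 y^{11} − 52632 x^6 y^{12} + 7344 x^4 y^{14} + 2448 x^3 y^{15}) as a polynomial in ℝ[x,y]. -/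
open scoped Classical

noncomputable section

/-- The field with four elements. -/
abbrev F4 := GaloisField 2 2

instance : Fintype F4 := Fintype.ofFinite _

/-- Membership in the quaternary quadratic residue code of length 17: the codeword, viewed
as the polynomial `∑ cᵢ Xⁱ` modulo `X ^ 17 - 1`, lies in the ideal generated by the
polynomial whose roots are `α ^ ℓ` for `ℓ` running over the nonzero squares mod 17;
equivalently (as that generator is separable and divides `X ^ 17 - 1`), the codeword
polynomial vanishes at `α ^ ℓ` for every nonzero square `ℓ` modulo 17. -/
def qr4Mem {K : Type} [Field K] [Algebra F4 K] (α : K) (c : Fin 17 → F4) : Prop :=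
  ∀ ℓ : ZMod 17, ℓ ≠ 0 → IsSquare ℓ →
    ∑ i : Fin 17, algebraMap F4 K (c i) * α ^ (ℓ.val * (i : ℕ)) = 0

/-- Membership in the extended quaternary quadratic residue code of length 18: the first 17
coordinates form a codeword of the quadratic residue code of length 17 and the last
coordinate is minus the sum of the first 17. -/
def extQR4Mem {K : Type} [Field K] [Algebra F4 K] (α : K) (c : Fin 18 → F4) : Prop :=
  qr4Mem α (fun i => c i.castSucc) ∧ c (Fin.last 17) = - ∑ i : Fin 17, c i.castSucc

/-- Hamming weight: the number of nonzero coordinates. -/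
def wt {n : ℕ} {F : Type} [Zero F] (c : Fin n → F) : ℕ :=
  (Finset.univ.filter fun i => c i ≠ 0).card

/-- Support: the set of nonzero coordinate positions. -/
def supp {n : ℕ} {F : Type} [Zero F] (c : Fin n → F) : Finset (Fin n) :=
  Finset.univ.filter fun i => c i ≠ 0

/-- The remainder of `X ^ n` modulo the polynomial `g` of degree 8 over the field with two
elements; polynomials are encoded by the binary digits of natural numbers. -/
def powMod (g : ℕ) : ℕ → ℕ
  | 0 => 1
  | n + 1 => if (powMod g n).testBit 7 then (2 * powMod g n) ^^^ g else 2 * powMod g n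

/-- The two factors of degree 8 of `X ^ 17 - 1` over the field with two elements. -/
def qrFactor : Bool → ℕ
  | false => 313
  | true => 471

theorem List.sum_map_pow_div_mod (B : ℕ) (W : List ℕ) (hW : W.length < B) (w : ℕ) :
    (W.map (B ^ ·)).sum / B ^ w % B = W.count w := by
  have key : ∃ A D, (W.map (B ^ ·)).sum = A + B ^ w * (W.count w + B * D) ∧
      A * B ≤ W.length * B ^ w := by
    have hB : 0 < B := by omega
    clear hW
    induction W with
    | nil => exact ⟨0, 0, by simp⟩
    | cons a W ih =>
      obtain ⟨A, D, h, hA⟩ := ih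
      simp only [List.map_cons, List.sum_cons, h, List.length_cons, List.count_cons, beq_iff_eq]
      rcases lt_trichotomy a w with haw | rfl | haw
      · refine ⟨A + B ^ a, D, by rw [if_neg haw.ne]; ring, ?_⟩
        have : B ^ (a + 1) ≤ B ^ w := Nat.pow_le_pow_right hB haw
        rw [pow_succ] at this
        nlinarith
      · exact ⟨A, D, by rw [if_pos rfl]; ring, by nlinarith [Nat.zero_le (B ^ a)]⟩
      · refine ⟨A, D + B ^ (a - (w + 1)), ?_, by nlinarith [Nat.zero_le (B ^ w)]⟩
        obtain ⟨d, rfl⟩ := Nat.exists_eq_add_of_lt haw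
        rw [if_neg haw.ne', show w + d + 1 - (w + 1) = d by omega]
        ring
  obtain ⟨A, D, h, hA⟩ := key
  have hB : 0 < B ^ w := Nat.pow_pos (by omega)
  have hlt : A < B ^ w := by
    by_contra! hc
    nlinarith
  have hcount : W.count w < B := List.count_le_length.trans_lt hW
  rw [h, Nat.add_mul_div_left _ _ hB, Nat.div_eq_of_lt hlt, zero_add, Nat.add_mul_mod_self_left,
    Nat.mod_eq_of_lt hcount]

/-- Summing over the supersets of the one-point extensions of `s`. -/
theorem sum_sum_insert_subset {ι M : Type*} [Fintype ι] [DecidableEq ι] [AddCommMonoid M]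
    (n : ℕ) (s : Finset ι) (F : Finset ι → M) :
    ∑ j ∈ sᶜ, ∑ z with z.card = n ∧ insert j s ⊆ z, F z =
      (n - s.card) • ∑ z with z.card = n ∧ s ⊆ z, F z := by
  rw [Finset.sum_comm' (t' := Finset.univ.filter fun z => z.card = n ∧ s ⊆ z)
    (s' := fun z => z \ s), Finset.smul_sum]
  · refine Finset.sum_congr rfl fun z hz => ?_
    obtain ⟨hz, hs⟩ := (Finset.mem_filter.1 hz).2
    rw [Finset.sum_const, Finset.card_sdiff_of_subset hs, hz]
  · intro j z
    simp only [Finset.mem_compl, Finset.mem_filter, Finset.mem_univ, true_and, Finset.mem_sdiff,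
      Finset.insert_subset_iff]
    tauto

theorem sum_superset_eq_zero {ι : Type*} [Fintype ι] [DecidableEq ι] {f : Finset ι → ℝ}
    (hf : ∀ y : Finset ι, y.card = 2 → ∑ z with z.card = 3 ∧ y ⊆ z, f z = 0) {s : Finset ι}
    (hs : s.card < 3) : ∑ z with z.card = 3 ∧ s ⊆ z, f z = 0 := by
  obtain hs' | hs' : s.card = 2 ∨ s.card < 2 := by omega
  · exact hf s hs'
  · have h := sum_sum_insert_subset 3 s f
    rw [Finset.sum_eq_zero fun j hj => sum_superset_eq_zero hf (s := insert j s) (by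
      rw [Finset.card_insert_of_notMem (Finset.mem_compl.1 hj)]; omega)] at h
    have h3 : 3 - s.card ≠ 0 := by omega
    simpa [h3] using h.symm
termination_by 3 - s.card
decreasing_by
  rw [Finset.card_insert_of_notMem (Finset.mem_compl.1 hj)]; omega

/-- Complementing changes the sign of the extension of a harmonic function of degree 3. -/
theorem sum_powersetCard_eq_neg_sum_disjoint {ι : Type*} [Fintype ι] [DecidableEq ι]
    {f : Finset ι → ℝ}
    (hf : ∀ y : Finset ι, y.card = 2 → ∑ z with z.card = 3 ∧ y ⊆ z, f z = 0) (u : Finset ι) :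
    ∑ z ∈ u.powersetCard 3, f z = -∑ z with z.card = 3 ∧ Disjoint z u, f z := by
  have h : ∑ z with z.card = 3, ∑ s ∈ z.powerset, (if s ⊆ u then (-1) ^ s.card * f z else 0) =
      ∑ z with z.card = 3 ∧ Disjoint z u, f z := by
    rw [← Finset.filter_filter, Finset.sum_filter (p := fun z => Disjoint z u)]
    refine Finset.sum_congr rfl fun z _ => ?_
    rw [← Finset.sum_filter]
    have : z.powerset.filter (· ⊆ u) = (z ∩ u).powerset := by
      ext s
      rw [Finset.mem_filter, Finset.mem_powerset, Finset.mem_powerset, Finset.subset_inter_iff]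
    rw [this, ← Finset.sum_mul]
    have := congrArg (Int.cast : ℤ → ℝ) (Finset.sum_powerset_neg_one_pow_card (x := z ∩ u))
    push_cast at this
    rw [this]
    simp [Finset.disjoint_iff_inter_eq_empty]
  rw [← h, Finset.sum_comm' (t' := Finset.univ.filter fun s => s.card ≤ 3)
    (s' := fun s => Finset.univ.filter fun z => z.card = 3 ∧ s ⊆ z)]
  · rw [← Finset.sum_neg_distrib]
    refine Eq.trans ?_ (Finset.sum_subset (s₁ := u.powersetCard 3) ?_ ?_)
    · refine Finset.sum_congr rfl fun s hs => ?_
      obtain ⟨hsu, hs⟩ := Finset.mem_powersetCard.1 hs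
      have : (Finset.univ.filter fun z : Finset ι => z.card = 3 ∧ s ⊆ z) = {s} := by
        ext z
        simp only [Finset.mem_filter, Finset.mem_univ, true_and, Finset.mem_singleton]
        refine ⟨fun hz => (Finset.eq_of_subset_of_card_le hz.2 (by omega)).symm, ?_⟩
        rintro rfl
        exact ⟨hs, subset_rfl⟩
      rw [this, Finset.sum_singleton, if_pos hsu, hs]
      ring
    · intro s hs
      simp [(Finset.mem_powersetCard.1 hs).2]
    · intro s hs hs'
      by_cases hsu : s ⊆ u
      · simp only [Finset.mem_filter, Finset.mem_univ, true_and] at hs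
        have : s.card ≠ 3 := fun h => hs' (Finset.mem_powersetCard.2 ⟨hsu, h⟩)
        simp only [if_pos hsu]
        rw [← Finset.mul_sum, sum_superset_eq_zero hf (by omega), mul_zero, neg_zero]
      · simp [hsu]
  · intro z s
    simp only [Finset.mem_filter, Finset.mem_univ, true_and, Finset.mem_powerset]
    exact ⟨fun ⟨h1, h2⟩ => ⟨⟨h1, h2⟩, h1 ▸ Finset.card_le_card h2⟩, fun h => h.1⟩

theorem filter_card_eq_image_insert {ι : Type*} [Fintype ι] [DecidableEq ι] (y : Finset ι) :
    (Finset.univ.filter fun z => z.card = y.card + 1 ∧ y ⊆ z) = yᶜ.image (insert · y) := by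
  ext z
  simp only [Finset.mem_filter, Finset.mem_univ, true_and, Finset.mem_image, Finset.mem_compl]
  constructor
  · rintro ⟨hz, hyz⟩
    obtain ⟨a, ha⟩ := Finset.card_eq_one.1 (show (z \ y).card = 1 by
      rw [Finset.card_sdiff_of_subset hyz]; omega)
    refine ⟨a, fun h => ?_, ?_⟩
    · have : a ∈ z \ y := ha ▸ Finset.mem_singleton_self a
      exact (Finset.mem_sdiff.1 this).2 h
    · rw [Finset.insert_eq, ← ha, Finset.sdiff_union_of_subset hyz]
  · rintro ⟨a, ha, rfl⟩
    exact ⟨Finset.card_insert_of_notMem ha, Finset.subset_insert _ _⟩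

/-- The value at `β` of the polynomial of degree at most 8 with binary coefficients `s`. -/
def bitEval {K : Type*} [Field K] (β : K) (s : ℕ) : K :=
  ∑ j ∈ Finset.range 9, if s.testBit j then β ^ j else 0

theorem bitEval_xor {K : Type*} [Field K] [CharP K 2] (β : K) (s t : ℕ) :
    bitEval β (s ^^^ t) = bitEval β s + bitEval β t := by
  simp only [bitEval, ← Finset.sum_add_distrib, Nat.testBit_xor]
  refine Finset.sum_congr rfl fun j _ => ?_
  cases s.testBit j <;> cases t.testBit j <;> simp [CharTwo.add_self_eq_zero]

theorem bitEval_two_mul {K : Type*} [Field K] (β : K) {s : ℕ} (hs : s.testBit 8 = false) :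
    bitEval β (2 * s) = β * bitEval β s := by
  rw [bitEval, bitEval, Finset.sum_range_succ', Finset.sum_range_succ _ 8, hs, mul_add,
    Finset.mul_sum]
  simp [Nat.testBit_succ, pow_succ', mul_ite]

theorem bitEval_powMod {K : Type*} [Field K] [CharP K 2] {β : K} {g : ℕ} (hg : bitEval β g = 0)
    {n : ℕ} (hn : ∀ m < n, (powMod g m).testBit 8 = false) : bitEval β (powMod g n) = β ^ n := by
  induction n with
  | zero =>
    have : ∀ j, Nat.testBit 1 j = decide (j = 0) := fun j => by
      rw [Bool.eq_iff_iff, Nat.testBit_one_eq_true_iff_self_eq_zero, decide_eq_true_iff]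
    simp [bitEval, powMod, this]
  | succ n ih =>
    rw [pow_succ', ← ih fun m hm => hn m (by omega), ← bitEval_two_mul β (hn n (by omega)), powMod]
    split_ifs
    · rw [bitEval_xor, hg, add_zero]
    · rfl

theorem powMod_qrFactor_testBit (b : Bool) :
    ∀ n < 17, (powMod (qrFactor b) n).testBit 8 = false := by
  revert b; decide +kernel

theorem exists_bitEval_qrFactor_eq_zero {K : Type*} [Field K] [CharP K 2] {α : K}
    (hα : IsPrimitiveRoot α 17) : ∃ b, bitEval α (qrFactor b) = 0 := by
  have h2 : (2 : K) = 0 := CharTwo.two_eq_zero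
  have h1 : α - 1 ≠ 0 := sub_ne_zero.2 (hα.ne_one (by norm_num))
  have hf : bitEval α (qrFactor false) = 1 + α ^ 3 + α ^ 4 + α ^ 5 + α ^ 8 := by
    have : ∀ j < 9, (qrFactor false).testBit j = decide (j ∈ [0, 3, 4, 5, 8]) := by decide
    simp [bitEval, Finset.sum_range_succ, this]
  have ht : bitEval α (qrFactor true) = 1 + α + α ^ 2 + α ^ 4 + α ^ 6 + α ^ 7 + α ^ 8 := by
    have : ∀ j < 9, (qrFactor true).testBit j = decide (j ∈ [0, 1, 2, 4, 6, 7, 8]) := by decide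
    simp [bitEval, Finset.sum_range_succ, this]
  have hmul : (α - 1) * (bitEval α (qrFactor false) * bitEval α (qrFactor true)) = 0 := by
    rw [hf, ht]
    ring_nf
    reduce_mod_char
    linear_combination hα.pow_eq_one + (α ^ 13 - α ^ 4) * h2
  rcases mul_eq_zero.1 ((mul_eq_zero.1 hmul).resolve_left h1) with h | h
  exacts [⟨false, h⟩, ⟨true, h⟩]

theorem bitEval_pow_two_pow {K : Type*} [Field K] [CharP K 2] {β : K} {g : ℕ}
    (hg : bitEval β g = 0) (k : ℕ) : bitEval (β ^ 2 ^ k) g = 0 := by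
  rw [← iterateFrobenius_def 2, show bitEval (iterateFrobenius K 2 k β) g =
    iterateFrobenius K 2 k (bitEval β g) by simp [bitEval, apply_ite], hg, map_zero]

/-- The squares modulo 17 are the powers of 2. -/
theorem exists_eq_two_pow_of_isSquare :
    ∀ ℓ : ZMod 17, ℓ ≠ 0 → IsSquare ℓ → ∃ k : Fin 8, ℓ = 2 ^ k.val := by
  decide

theorem card_squares : (Finset.univ.filter fun ℓ : ZMod 17 => ℓ ≠ 0 ∧ IsSquare ℓ).card = 8 := by
  decide

theorem bitEval_pow_val {K : Type*} [Field K] [CharP K 2] {α : K}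
    (hα : IsPrimitiveRoot α 17) {g : ℕ} (hg : bitEval α g = 0) {ℓ : ZMod 17} (h0 : ℓ ≠ 0)
    (h : IsSquare ℓ) : bitEval (α ^ ℓ.val) g = 0 := by
  obtain ⟨k, rfl⟩ := exists_eq_two_pow_of_isSquare ℓ h0 h
  have : α ^ ((2 : ZMod 17) ^ k.val).val = α ^ 2 ^ k.val := by
    have h : ((2 : ZMod 17) ^ k.val).val = 2 ^ k.val % 17 := by
      rw [← ZMod.val_natCast, Nat.cast_pow, Nat.cast_ofNat]
    rw [h]
    conv_lhs => rw [hα.eq_orderOf, pow_mod_orderOf]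
  rw [this]
  exact bitEval_pow_two_pow hg _

/-- Membership in the quadratic residue code in terms of the remainders modulo its generator. -/
theorem qr4Mem_iff {K : Type} [Field K] [CharP K 2] [Algebra F4 K] {α : K}
    (hα : IsPrimitiveRoot α 17) {b : Bool} (hb : bitEval α (qrFactor b) = 0) (c : Fin 17 → F4) :
    qr4Mem α c ↔ ∀ j < 8,
      ∑ i : Fin 17, (if (powMod (qrFactor b) i).testBit j then c i else 0) = 0 := by
  set p : Polynomial K := ∑ j ∈ Finset.range 8, Polynomial.C (algebraMap F4 K
    (∑ i : Fin 17, (if (powMod (qrFactor b) i).testBit j then c i else 0))) *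
      Polynomial.X ^ j with hp
  have heval : ∀ ℓ : ZMod 17, ℓ ≠ 0 → IsSquare ℓ →
      ∑ i : Fin 17, algebraMap F4 K (c i) * α ^ (ℓ.val * (i : ℕ)) = p.eval (α ^ ℓ.val) := by
    intro ℓ h0 h
    have hg := bitEval_pow_val hα hb h0 h
    simp only [hp, Polynomial.eval_finsetSum, Polynomial.eval_mul, Polynomial.eval_C,
      Polynomial.eval_pow, Polynomial.eval_X, map_sum, Finset.sum_mul]
    rw [Finset.sum_comm]
    refine Finset.sum_congr rfl fun i _ => ?_
    rw [pow_mul, ← bitEval_powMod hg fun m hm => powMod_qrFactor_testBit b m (by omega), bitEval,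
      Finset.sum_range_succ, powMod_qrFactor_testBit b i i.isLt, if_neg Bool.false_ne_true,
      add_zero, Finset.mul_sum]
    simp [apply_ite (algebraMap F4 K)]
  have hdeg : p.natDegree < 8 := by
    rw [Nat.lt_iff_le_pred (by norm_num)]
    refine Polynomial.natDegree_sum_le_of_forall_le _ _ fun j hj => ?_
    exact (Polynomial.natDegree_C_mul_X_pow_le _ _).trans (by have := Finset.mem_range.1 hj; omega)
  have hcoeff : ∀ j < 8, p.coeff j = algebraMap F4 K
    (∑ i : Fin 17, (if (powMod (qrFactor b) i).testBit j then c i else 0)) := by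
    intro j hj
    simp [hp, Polynomial.coeff_C_mul, Polynomial.coeff_X_pow, -map_sum, hj]
  constructor
  · intro h
    have hp0 : p = 0 := by
      refine Polynomial.eq_zero_of_natDegree_lt_card_of_eval_eq_zero' p
        ((Finset.univ.filter fun ℓ : ZMod 17 => ℓ ≠ 0 ∧ IsSquare ℓ).image (α ^ ·.val)) ?_ ?_
      · intro x hx
        obtain ⟨ℓ, hℓ, rfl⟩ := Finset.mem_image.1 hx
        obtain ⟨h0, hs⟩ := (Finset.mem_filter.1 hℓ).2
        rw [← heval ℓ h0 hs, h ℓ h0 hs]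
      · rw [Finset.card_image_of_injective, card_squares]
        · exact hdeg
        · exact fun x y hxy =>
            ZMod.val_injective 17 (hα.pow_inj (ZMod.val_lt x) (ZMod.val_lt y) hxy)
    intro j hj
    refine (algebraMap F4 K).injective ?_
    rw [← hcoeff j hj, hp0, Polynomial.coeff_zero, map_zero]
  · intro h ℓ h0 hs
    have hp0 : p = 0 := Finset.sum_eq_zero fun j hj => by
      rw [h j (Finset.mem_range.1 hj), map_zero, Polynomial.C_0, zero_mul]
    rw [heval ℓ h0 hs, hp0, Polynomial.eval_zero]

/-- The number of ones among the last `k` binary digits of `n`. -/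
def popCount : ℕ → ℕ → ℕ
  | 0, _ => 0
  | k + 1, n => n % 2 + popCount k (n / 2)

/-- The rows of the systematic generator matrix. -/
def genRow (b : Bool) (j : ℕ) : ℕ :=
  powMod (qrFactor b) (8 + j) + 2 ^ (8 + j) +
    (popCount 8 (powMod (qrFactor b) (8 + j)) + 1) % 2 * 2 ^ 17

/-- The sum of those rows `r 0, …, r (k - 1)` that are selected by the binary digits of `n`. -/
def xorRows (r : ℕ → ℕ) : ℕ → ℕ → ℕ
  | 0, _ => 0
  | k + 1, n => xorRows r k n ^^^ (if n.testBit k then r k else 0)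

/-- The binary codewords that vanish at 17, 0 and `k`. -/
def wordsAvoiding (b : Bool) (k : ℕ) : List ℕ :=
  ((List.range 512).map (xorRows (genRow b) 9)).filter
    fun w => !w.testBit 17 && !w.testBit 0 && !w.testBit k

/-- The information positions of the systematic generator matrix. -/
def infoPos (j : Fin 9) : Fin 18 := ⟨8 + j, by omega⟩

/-- The systematic generator matrix. -/
def genMat (b : Bool) (j : Fin 9) (i : Fin 18) : ZMod 2 :=
  if (genRow b j).testBit i then 1 else 0

/-- A parity check matrix of the code. -/
def checkMat (b : Bool) (j : Fin 9) (i : Fin 18) : ZMod 2 :=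
  if j = 8 then 1 else if i = 17 then 0 else if (powMod (qrFactor b) i).testBit j then 1 else 0

/-- The permutation `i ↦ i + 1` of the projective line over `ZMod 17`, with 17 as infinity. -/
def shiftPerm : Equiv.Perm (Fin 18) where
  toFun i := if i = 17 then 17 else if i = 16 then 0 else i + 1
  invFun i := if i = 17 then 17 else if i = 0 then 16 else i - 1
  left_inv := by unfold Function.LeftInverse; decide
  right_inv := by unfold Function.RightInverse Function.LeftInverse; decide

/-- The permutation `i ↦ 2 * i` of the projective line over `ZMod 17`. -/
def doublePerm : Equiv.Perm (Fin 18) where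
  toFun i := if i = 17 then 17 else Fin.ofNat 18 (2 * i.val % 17)
  invFun i := if i = 17 then 17 else Fin.ofNat 18 (9 * i.val % 17)
  left_inv := by unfold Function.LeftInverse; decide
  right_inv := by unfold Function.RightInverse Function.LeftInverse; decide

/-- The permutation `i ↦ -1 / i` of the projective line over `ZMod 17`. -/
def invPerm : Equiv.Perm (Fin 18) where
  toFun i := if i = 17 then 0 else if i = 0 then 17 else Fin.ofNat 18 (17 - i.val ^ 15 % 17)
  invFun i := if i = 17 then 0 else if i = 0 then 17 else Fin.ofNat 18 (17 - i.val ^ 15 % 17)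
  left_inv := by unfold Function.LeftInverse; decide
  right_inv := by unfold Function.RightInverse Function.LeftInverse; decide

theorem checkMat_genMat (b : Bool) : ∀ k j, ∑ i, checkMat b k i * genMat b j i = 0 := by
  revert b; decide +kernel

/-- Row operations that bring `checkMat` into systematic form. -/
def solveMat (i : Fin 18) (k : Fin 9) : ZMod 2 :=
  if i = 17 then 1 else if i.val = k.val ∧ k ≠ 8 then 1 else 0

theorem solveMat_checkMat (b : Bool) : ∀ i m, ∑ k, solveMat i k * checkMat b k m =
    (if m = i then 1 else 0) + ∑ j : Fin 9, genMat b j i * if m = infoPos j then 1 else 0 := by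
  revert b; decide +kernel

theorem genMat_shiftPerm (b : Bool) : ∀ l i, genMat b l (shiftPerm i) =
    ∑ j : Fin 9, genMat b j i * genMat b l (shiftPerm (infoPos j)) := by
  revert b; decide +kernel

theorem genMat_doublePerm (b : Bool) : ∀ l i, genMat b l (doublePerm i) =
    ∑ j : Fin 9, genMat b j i * genMat b l (doublePerm (infoPos j)) := by
  revert b; decide +kernel

theorem genMat_invPerm (b : Bool) : ∀ l i, genMat b l (invPerm i) =
    ∑ j : Fin 9, genMat b j i * genMat b l (invPerm (infoPos j)) := by
  revert b; decide +kernel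

theorem genMat_eq_sum (b : Bool) :
    ∀ l i, genMat b l i = ∑ j : Fin 9, genMat b j i * genMat b l (infoPos j) := by
  revert b; decide +kernel

theorem shiftPerm_pow_apply :
    ∀ i : Fin 18, i ≠ 17 → (shiftPerm ^ i.val) 17 = 17 ∧ (shiftPerm ^ i.val) 0 = i := by
  decide +kernel

theorem nodup_wordsAvoiding (b : Bool) :
    (wordsAvoiding b 1).Nodup ∧ (wordsAvoiding b 3).Nodup := by
  revert b; decide +kernel

theorem wordsAvoiding_lt (b : Bool) :
    (∀ n ∈ wordsAvoiding b 1, n < 2 ^ 18) ∧ ∀ n ∈ wordsAvoiding b 3, n < 2 ^ 18 := by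
  revert b; decide +kernel

/-- The `i`-th binary digit of `n`. -/
def bit (n i : ℕ) : ZMod 2 := if n.testBit i then 1 else 0

theorem bit_xor (m n i : ℕ) : bit (m ^^^ n) i = bit m i + bit n i := by
  rw [bit, bit, bit, Nat.testBit_xor]
  cases m.testBit i <;> cases n.testBit i <;> decide

theorem bit_ne_zero {n i : ℕ} : bit n i ≠ 0 ↔ n.testBit i := by simp [bit]

theorem bit_eq_zero {n i : ℕ} : bit n i = 0 ↔ n.testBit i = false := by simp [bit]

theorem bit_injOn {k : ℕ} {m n : ℕ} (hm : m < 2 ^ k) (hn : n < 2 ^ k)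
    (h : ∀ i : Fin k, bit m i = bit n i) : m = n := by
  refine Nat.eq_of_testBit_eq fun i => ?_
  by_cases hi : i < k
  · have := h ⟨i, hi⟩
    rw [Bool.eq_iff_iff, ← bit_ne_zero, ← bit_ne_zero]
    simp_all
  · have hk : 2 ^ k ≤ 2 ^ i := Nat.pow_le_pow_right (by norm_num) (not_lt.1 hi)
    rw [Nat.testBit_lt_two_pow (hm.trans_le hk), Nat.testBit_lt_two_pow (hn.trans_le hk)]

theorem bit_xorRows (r : ℕ → ℕ) (k n i : ℕ) :
    bit (xorRows r k n) i = ∑ j : Fin k, bit (r j) i * bit n j := by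
  induction k with
  | zero => simp [xorRows, bit]
  | succ k ih =>
    rw [xorRows, bit_xor, ih, Fin.sum_univ_castSucc]
    congr 1
    simp only [Fin.val_last, bit]
    split_ifs <;> simp_all

theorem popCount_eq_card (k n : ℕ) :
    popCount k n = (Finset.univ.filter fun i : Fin k => n.testBit i).card := by
  induction k generalizing n with
  | zero => simp [popCount]
  | succ k ih =>
    rw [popCount, ih, Fin.card_filter_univ_succ]
    simp only [Fin.val_zero, Nat.testBit_zero, Fin.val_succ, Nat.testBit_succ]
    rcases Nat.mod_two_eq_zero_or_one n with h | h <;> simp [h, add_comm]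

/-- The words spanned by the generator matrix, with coordinates in any module over `ZMod 2`. -/
def IsWord {M : Type*} [AddCommGroup M] [Module (ZMod 2) M] (b : Bool) (c : Fin 18 → M) : Prop :=
  ∀ i, c i = ∑ j, genMat b j i • c (infoPos j)

theorem isWord_iff_checkMat {M : Type*} [AddCommGroup M] [Module (ZMod 2) M] {b : Bool}
    {c : Fin 18 → M} : IsWord b c ↔ ∀ k, ∑ i, checkMat b k i • c i = 0 := by
  constructor
  · intro h k
    calc ∑ i, checkMat b k i • c i
        = ∑ i, ∑ j, (checkMat b k i * genMat b j i) • c (infoPos j) := by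
          refine Finset.sum_congr rfl fun i _ => ?_
          rw [h i, Finset.smul_sum]
          simp only [mul_smul]
      _ = 0 := by
          rw [Finset.sum_comm]
          refine Finset.sum_eq_zero fun j _ => ?_
          rw [← Finset.sum_smul, checkMat_genMat, zero_smul]
  · intro h i
    have key : ∑ m, (∑ k, solveMat i k * checkMat b k m) • c m = 0 := by
      simp only [Finset.sum_smul, mul_smul]
      rw [Finset.sum_comm]
      refine Finset.sum_eq_zero fun k _ => ?_
      rw [← Finset.smul_sum, h k, smul_zero]
    simp only [solveMat_checkMat, add_smul, Finset.sum_add_distrib, Finset.sum_smul] at key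
    rw [Finset.sum_comm (s := Finset.univ (α := Fin 18))] at key
    simp only [ite_smul, one_smul, zero_smul, mul_ite, mul_one, mul_zero, Finset.sum_ite_eq',
      Finset.mem_univ, if_true] at key
    have h2 : ∀ x y : M, x + y = 0 → x = y := fun x y hxy => by
      have : y + y = 0 := by rw [← two_smul (ZMod 2) y, show (2 : ZMod 2) = 0 by decide, zero_smul]
      exact add_right_cancel (hxy.trans this.symm)
    exact h2 _ _ key

theorem IsWord.comp_perm {M : Type*} [AddCommGroup M] [Module (ZMod 2) M] {b : Bool}
    {σ : Equiv.Perm (Fin 18)}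
    (hσ : ∀ l i, genMat b l (σ i) = ∑ j, genMat b j i * genMat b l (σ (infoPos j)))
    {c : Fin 18 → M} (hc : IsWord b c) : IsWord b (c ∘ σ) := by
  intro i
  calc c (σ i) = ∑ l, (∑ j, genMat b j i * genMat b l (σ (infoPos j))) • c (infoPos l) := by
        rw [hc (σ i)]
        simp only [hσ _ i]
    _ = ∑ j, genMat b j i • c (σ (infoPos j)) := by
        simp only [Finset.sum_smul]
        rw [Finset.sum_comm]
        refine Finset.sum_congr rfl fun j _ => ?_
        rw [hc (σ (infoPos j)), Finset.smul_sum]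
        simp only [mul_smul]

theorem isWord_zmod_iff {b : Bool} {a : Fin 18 → ZMod 2} :
    IsWord b a ↔ ∃ n < 512, ∀ i : Fin 18, a i = bit (xorRows (genRow b) 9 n) i := by
  constructor
  · intro h
    refine ⟨Nat.ofBits fun j : Fin 9 => decide (a (infoPos j) = 1), Nat.ofBits_lt_two_pow _,
      fun i => ?_⟩
    rw [h i, bit_xorRows]
    refine Finset.sum_congr rfl fun j _ => ?_
    rw [smul_eq_mul]
    congr 1
    rw [bit, Nat.testBit_ofBits_lt _ _ j.isLt]
    generalize a (infoPos j) = x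
    revert x
    decide
  · rintro ⟨n, -, h⟩ i
    simp only [h, bit_xorRows, smul_eq_mul]
    simp only [Finset.mul_sum]
    rw [Finset.sum_comm]
    refine Finset.sum_congr rfl fun l _ => ?_
    rw [show bit (genRow b l) i = genMat b l i from rfl, genMat_eq_sum, Finset.sum_mul]
    refine Finset.sum_congr rfl fun j _ => ?_
    rw [mul_assoc]
    rfl

theorem sum_isWord_avoiding {M : Type*} [AddCommMonoid M] (b : Bool) {k : Fin 18}
    (hk : k = 1 ∨ k = 3) (φ : (Fin 18 → ZMod 2) → M) :
    ∑ a with IsWord b a ∧ ∀ i ∈ ({17, 0, k} : Finset (Fin 18)), a i = 0, φ a =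
      ((wordsAvoiding b k).map fun n => φ fun i => bit n i).sum := by
  have hnodup : (wordsAvoiding b k).Nodup := by
    rcases hk with rfl | rfl
    exacts [(nodup_wordsAvoiding b).1, (nodup_wordsAvoiding b).2]
  have hlt : ∀ n ∈ wordsAvoiding b k, n < 2 ^ 18 := by
    rcases hk with rfl | rfl
    exacts [(wordsAvoiding_lt b).1, (wordsAvoiding_lt b).2]
  rw [← List.sum_toFinset _ hnodup, ← Finset.sum_image (f := φ)
    (g := fun (n : ℕ) (i : Fin 18) => bit n i) (s := (wordsAvoiding b k).toFinset)]
  · refine Finset.sum_congr ?_ fun _ _ => rfl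
    ext a
    simp only [Finset.mem_filter, Finset.mem_univ, true_and, Finset.mem_image, List.mem_toFinset,
      wordsAvoiding, List.mem_filter, List.mem_map, List.mem_range, Finset.forall_mem_insert,
      Finset.mem_singleton, forall_eq, isWord_zmod_iff, Bool.and_eq_true, Bool.not_eq_true',
      ← bit_eq_zero]
    constructor
    · rintro ⟨⟨n, hn, h⟩, h17, h0, hk'⟩
      exact ⟨_, ⟨⟨n, hn, rfl⟩, ⟨(h 17).symm.trans h17, (h 0).symm.trans h0⟩, (h k).symm.trans hk'⟩,
        funext fun i => (h i).symm⟩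
    · rintro ⟨m, ⟨⟨n, hn, rfl⟩, ⟨h17, h0⟩, hk'⟩, rfl⟩
      exact ⟨⟨n, hn, fun i => rfl⟩, h17, h0, hk'⟩
  · intro m hm n hn h
    exact bit_injOn (hlt m (List.mem_toFinset.1 hm)) (hlt n (List.mem_toFinset.1 hn)) (congrFun h)

/-- The weights of the codewords over the field with four elements that vanish at 17, 0 and `k`. -/
def unionWeights (b : Bool) (k : ℕ) : List ℕ :=
  (wordsAvoiding b k).flatMap fun m => (wordsAvoiding b k).map fun n => popCount 18 (m ||| n)

/-- The weight distribution of the codewords over the field with four elements vanishing at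
three coordinates; there are two orbits of triples. -/
def weightCount : Bool → List ℕ
  | false => [1, 0, 0, 0, 0, 0, 81, 0, 72, 318, 855, 1008, 783, 630, 288, 60, 0, 0, 0]
  | true => [1, 0, 0, 0, 0, 0, 84, 0, 63, 354, 846, 882, 912, 630, 270, 54, 0, 0, 0]

theorem sum_map_pow_unionWeights : ∀ b,
    ((unionWeights b 1).map ((2 ^ 16) ^ ·)).sum = Nat.ofDigits (2 ^ 16) (weightCount b) ∧
    ((unionWeights b 3).map ((2 ^ 16) ^ ·)).sum = Nat.ofDigits (2 ^ 16) (weightCount !b) := by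
  simp only [unionWeights, List.flatMap_def, List.map_flatten, List.sum_flatten, List.map_map,
    Function.comp_def]
  decide +kernel

theorem length_unionWeights (b : Bool) :
    (unionWeights b 1).length < 2 ^ 16 ∧ (unionWeights b 3).length < 2 ^ 16 := by
  simp only [unionWeights, List.length_flatMap, List.length_map]
  revert b; decide +kernel

theorem count_unionWeights (b : Bool) : ∀ w < 19,
    (unionWeights b 1).count w = (weightCount b).getD w 0 ∧
    (unionWeights b 3).count w = (weightCount !b).getD w 0 := by
  have h : ∀ b, ∀ w < 19, Nat.ofDigits (2 ^ 16) (weightCount b) / (2 ^ 16) ^ w % 2 ^ 16 =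
      (weightCount b).getD w 0 := by decide +kernel
  intro w hw
  rw [← List.sum_map_pow_div_mod _ _ (length_unionWeights b).1,
    ← List.sum_map_pow_div_mod _ _ (length_unionWeights b).2, (sum_map_pow_unionWeights b).1,
    (sum_map_pow_unionWeights b).2]
  exact ⟨h _ w hw, h _ w hw⟩

theorem popCount_le (k n : ℕ) : popCount k n ≤ k := by
  rw [popCount_eq_card]
  exact (Finset.card_filter_le _ _).trans (by simp)

theorem sum_unionWeights {M : Type*} [AddCommMonoid M] (b : Bool) (k : ℕ) (φ : ℕ → M) :
    ((unionWeights b k).map φ).sum =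
      ∑ w ∈ Finset.range 19, (unionWeights b k).count w • φ w := by
  rw [Finset.sum_list_map_count]
  refine Finset.sum_subset (fun w hw => ?_) fun w _ hw => ?_
  · simp only [unionWeights, List.mem_toFinset, List.mem_flatMap, List.mem_map] at hw
    obtain ⟨m, -, n, -, rfl⟩ := hw
    exact Finset.mem_range.2 (Nat.lt_succ_of_le (popCount_le _ _))
  · rw [List.count_eq_zero_of_not_mem (by simpa using hw), zero_smul]

theorem exists_linearEquiv_F4 : Nonempty (F4 ≃ₗ[ZMod 2] ZMod 2 × ZMod 2) := by
  refine ⟨LinearEquiv.ofFinrankEq _ _ ?_⟩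
  rw [GaloisField.finrank 2 (by norm_num)]
  simp

theorem sum_wt_isWord_avoiding {M : Type*} [AddCommMonoid M] (b : Bool) {k : Fin 18}
    (hk : k = 1 ∨ k = 3) (φ : ℕ → M) :
    ∑ c : Fin 18 → F4 with IsWord b c ∧ ∀ i ∈ ({17, 0, k} : Finset (Fin 18)), c i = 0, φ (wt c) =
      ((unionWeights b k).map φ).sum := by
  obtain ⟨e⟩ := exists_linearEquiv_F4
  let E : (Fin 18 → F4) ≃ (Fin 18 → ZMod 2) × (Fin 18 → ZMod 2) :=
    (Equiv.arrowCongr (Equiv.refl _) e.toEquiv).trans (Equiv.arrowProdEquivProdArrow _ _ _)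
  have hE1 : ∀ c i, (E c).1 i = (e (c i)).1 := fun _ _ => rfl
  have hE2 : ∀ c i, (E c).2 i = (e (c i)).2 := fun _ _ => rfl
  have hzero : ∀ c i, c i = 0 ↔ (E c).1 i = 0 ∧ (E c).2 i = 0 := fun c i => by
    rw [hE1, hE2, ← Prod.mk_eq_zero, Prod.mk.eta, LinearEquiv.map_eq_zero_iff]
  have hword : ∀ c, IsWord b c ↔ IsWord b (E c).1 ∧ IsWord b (E c).2 := fun c => by
    simp only [IsWord, hE1, hE2, ← forall_and]
    refine forall_congr' fun i => ?_
    rw [← e.injective.eq_iff, Prod.ext_iff]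
    simp [Prod.fst_sum, Prod.snd_sum]
  let s := Finset.univ.filter fun a : Fin 18 → ZMod 2 =>
    IsWord b a ∧ ∀ i ∈ ({17, 0, k} : Finset (Fin 18)), a i = 0
  rw [Finset.sum_equiv E (t := s ×ˢ s) (g := fun p =>
    φ (Finset.univ.filter fun i => p.1 i ≠ 0 ∨ p.2 i ≠ 0).card)]
  · rw [Finset.sum_product]
    simp only [s, sum_isWord_avoiding b hk]
    simp only [unionWeights, List.flatMap_def, List.map_flatten, List.sum_flatten, List.map_map,
      Function.comp_def, bit_ne_zero, popCount_eq_card, Nat.testBit_or, Bool.or_eq_true]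
  · intro c
    simp only [s, Finset.mem_filter, Finset.mem_univ, true_and, Finset.mem_product, hword, hzero]
    grind
  · intro c _
    simp only [wt, ne_eq, hzero, not_and_or]

/-- The permutations of the coordinates preserving a set of words. -/
def coordAut {M : Type*} (P : (Fin 18 → M) → Prop) : Subgroup (Equiv.Perm (Fin 18)) where
  carrier := {σ | ∀ c, P c → P (c ∘ σ)}
  one_mem' _ hc := hc
  mul_mem' hσ hτ c hc := hτ _ (hσ c hc)
  inv_mem' {σ} hσ := by
    obtain ⟨n, hn⟩ := (isOfFinOrder_of_finite σ).mem_powers_iff_mem_zpowers.2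
      (inv_mem (Subgroup.mem_zpowers σ))
    simp only at hn
    rw [← hn]
    have key : ∀ n c, P c → P (c ∘ ⇑(σ ^ n)) := by
      intro n
      induction n with
      | zero => exact fun c hc => hc
      | succ n ih =>
        intro c hc
        rw [pow_succ, Equiv.Perm.coe_mul, ← Function.comp_assoc]
        exact hσ _ (ih c hc)
    exact key n

theorem exists_mem_map_pair {A : Subgroup (Equiv.Perm (Fin 18))} (hs : shiftPerm ∈ A)
    (hi : invPerm ∈ A) {i j : Fin 18} (hij : i ≠ j) : ∃ τ ∈ A, τ 17 = i ∧ τ 0 = j := by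
  have hpow : ∀ j : Fin 18, j ≠ 17 → ∃ τ ∈ A, τ 17 = 17 ∧ τ 0 = j := fun j hj =>
    ⟨_, A.pow_mem hs j, shiftPerm_pow_apply j hj⟩
  by_cases h : i = 17
  · subst h
    exact hpow j hij.symm
  · obtain ⟨σ, hσ, h17, h0⟩ := hpow i h
    have hinv : invPerm 17 = 0 ∧ invPerm 0 = 17 := by decide
    have hne : (σ * invPerm)⁻¹ j ≠ 17 := by
      rw [Ne, Equiv.Perm.inv_eq_iff_eq, Equiv.Perm.mul_apply, hinv.1, h0]
      exact hij.symm
    obtain ⟨τ, hτ, h17', h0'⟩ := hpow _ hne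
    refine ⟨σ * invPerm * τ, A.mul_mem (A.mul_mem hσ hi) hτ, ?_, ?_⟩
    · rw [Equiv.Perm.mul_apply, h17', Equiv.Perm.mul_apply, hinv.1, h0]
    · rw [Equiv.Perm.mul_apply, h0', ← Equiv.Perm.mul_apply, mul_inv_cancel, Equiv.Perm.one_apply]

theorem sum_superset_image {ι M : Type*} [Fintype ι] [DecidableEq ι] [AddCommMonoid M] {n : ℕ}
    {F : Finset ι → M} {σ : Equiv.Perm ι}
    (hF : ∀ z : Finset ι, z.card = n → F (z.image σ) = F z) (y : Finset ι) :
    ∑ z with z.card = n ∧ y.image σ ⊆ z, F z = ∑ z with z.card = n ∧ y ⊆ z, F z := by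
  symm
  refine Finset.sum_equiv σ.finsetCongr (fun z => ?_) fun z hz => ?_
  · simp [Finset.map_eq_image, Finset.image_subset_image_iff σ.injective,
      Finset.card_image_of_injective _ σ.injective]
  · simp only [Equiv.finsetCongr_apply, Finset.map_eq_image]
    exact (hF z (Finset.mem_filter.1 hz).2.1).symm

theorem doublePerm_orbits : ∀ k : Fin 18, k ≠ 17 → k ≠ 0 → ∃ e : Fin 8,
    (doublePerm ^ e.val) 17 = 17 ∧ (doublePerm ^ e.val) 0 = 0 ∧
      (doublePerm ^ e.val) (if IsSquare (k.val : ZMod 17) then 1 else 3) = k := by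
  decide +kernel

theorem sum_superset_pair {M : Type*} [AddCommMonoid M] {F : Finset (Fin 18) → M}
    (hF : ∀ z : Finset (Fin 18), z.card = 3 → F (z.image doublePerm) = F z) :
    ∑ z with z.card = 3 ∧ {17, 0} ⊆ z, F z = 8 • F {17, 0, 1} + 8 • F {17, 0, 3} := by
  have hpow : ∀ (e : ℕ) (z : Finset (Fin 18)), z.card = 3 →
      F (z.image ⇑(doublePerm ^ e)) = F z := by
    intro e
    induction e with
    | zero => simp
    | succ e ih =>
      intro z hz
      rw [pow_succ', Equiv.Perm.coe_mul, ← Finset.image_image, hF, ih z hz]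
      rw [Finset.card_image_of_injective _ (Equiv.injective _), hz]
  have hval : ∀ k : Fin 18, k ≠ 17 → k ≠ 0 →
      F {k, 17, 0} = if IsSquare (k.val : ZMod 17) then F {17, 0, 1} else F {17, 0, 3} := by
    intro k h17 h0
    obtain ⟨e, he17, he0, he⟩ := doublePerm_orbits k h17 h0
    have hrot : ({k, 17, 0} : Finset (Fin 18)) = {17, 0, k} := by
      ext; simp only [Finset.mem_insert, Finset.mem_singleton]; tauto
    rw [hrot]
    split_ifs at he ⊢
    · rw [← hpow e.val {17, 0, 1} (by decide)]
      simp [Finset.image_insert, he17, he0, he]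
    · rw [← hpow e.val {17, 0, 3} (by decide)]
      simp [Finset.image_insert, he17, he0, he]
  have h := filter_card_eq_image_insert ({17, 0} : Finset (Fin 18))
  rw [show ({17, 0} : Finset (Fin 18)).card + 1 = 3 by decide] at h
  rw [h, Finset.sum_image]
  · rw [Finset.sum_congr rfl fun k hk =>
        hval k (by rintro rfl; simp at hk) (by rintro rfl; simp at hk),
      Finset.sum_ite, Finset.sum_const, Finset.sum_const]
    congr 2
  · intro k hk l hl hkl
    have : k ∈ insert l ({17, 0} : Finset (Fin 18)) := by
      rw [← show insert k ({17, 0} : Finset (Fin 18)) = insert l {17, 0} from hkl]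
      exact Finset.mem_insert_self k _
    exact (Finset.mem_insert.1 this).resolve_right (Finset.mem_compl.1 hk)

/-- The sum of an invariant function over all triples. -/
theorem sum_triples {M : Type*} [AddCommGroup M] [Module ℝ M]
    {A : Subgroup (Equiv.Perm (Fin 18))} (hs : shiftPerm ∈ A)
    (hi : invPerm ∈ A) (hd : doublePerm ∈ A) {F : Finset (Fin 18) → M}
    (hF : ∀ σ ∈ A, ∀ z : Finset (Fin 18), z.card = 3 → F (z.image σ) = F z) :
    ∑ z with z.card = 3, F z = (408 : ℝ) • (F {17, 0, 1} + F {17, 0, 3}) := by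
  have hpair : ∀ i j : Fin 18, i ≠ j → ∑ z with z.card = 3 ∧ {j, i} ⊆ z, F z =
      8 • F {17, 0, 1} + 8 • F {17, 0, 3} := by
    intro i j hij
    obtain ⟨τ, hτ, h17, h0⟩ := exists_mem_map_pair hs hi hij.symm
    have h := (sum_superset_image (hF τ hτ) {17, 0}).trans (sum_superset_pair (hF _ hd))
    rwa [Finset.image_insert, Finset.image_singleton, h17, h0] at h
  have hone : ∀ i : Fin 18, 2 • ∑ z with z.card = 3 ∧ {i} ⊆ z, F z =
      17 • (8 • F {17, 0, 1} + 8 • F {17, 0, 3}) := by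
    intro i
    have h := sum_sum_insert_subset 3 {i} F
    rw [Finset.card_singleton] at h
    rw [← h, Finset.sum_congr rfl fun j hj => hpair i j (by rintro rfl; simp at hj),
      Finset.sum_const, Finset.card_compl, Finset.card_singleton, Fintype.card_fin]
  have hall := congrArg (2 • ·) (sum_sum_insert_subset 3 ∅ F)
  simp only [Finset.smul_sum (s := (∅ : Finset (Fin 18))ᶜ), insert_empty_eq, hone,
    Finset.sum_const, Finset.card_compl, Finset.card_empty, Fintype.card_fin,
    Finset.empty_subset, and_true, Nat.sub_zero] at hall
  simp only [← Nat.cast_smul_eq_nsmul ℝ, smul_smul, smul_add] at hall ⊢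
  push_cast at hall
  have h6 : (6 : ℝ) ≠ 0 := by norm_num
  refine smul_right_injective M h6 ?_
  simp only [smul_add, smul_smul]
  convert hall.symm using 2 <;> norm_num

theorem wt_comp_perm {σ : Equiv.Perm (Fin 18)} (c : Fin 18 → F4) : wt (c ∘ σ) = wt c :=
  Finset.card_equiv σ (by simp)

theorem extQR4Mem_iff_isWord {K : Type} [Field K] [Algebra F4 K] {α : K}
    (hα : IsPrimitiveRoot α 17) : ∃ b, ∀ c, extQR4Mem α c ↔ IsWord b c := by
  have : CharP K 2 := charP_of_injective_algebraMap (algebraMap F4 K).injective 2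
  obtain ⟨b, hb⟩ := exists_bitEval_qrFactor_eq_zero hα
  refine ⟨b, fun c => ?_⟩
  rw [extQR4Mem, qr4Mem_iff hα hb, isWord_iff_checkMat, Fin.forall_fin_succ', and_congr]
  · rw [← Fin.forall_iff (p := fun j : Fin 8 => ∑ i : Fin 17,
      (if (powMod (qrFactor b) i).testBit j then c i.castSucc else 0) = 0)]
    refine forall_congr' fun j => ?_
    have hj : j.castSucc ≠ (8 : Fin 9) := Fin.castSucc_ne_last j
    have hi (i : Fin 17) : i.castSucc ≠ (17 : Fin 18) := Fin.castSucc_ne_last i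
    rw [Fin.sum_univ_castSucc (n := 17)]
    simp [checkMat, hj, hi, show Fin.last 17 = 17 from rfl]
  · rw [eq_neg_iff_add_eq_zero, add_comm, Fin.sum_univ_castSucc (n := 17)]
    simp [checkMat, show Fin.last 8 = 8 from rfl]

/-- The weight enumerator of the codewords that vanish on `z`. -/
def avoidEnum (P : (Fin 18 → F4) → Prop) (z : Finset (Fin 18)) : MvPolynomial (Fin 2) ℝ :=
  ∑ c with P c ∧ ∀ i ∈ z, c i = 0, MvPolynomial.X 0 ^ (18 - wt c) * MvPolynomial.X 1 ^ wt c

theorem avoidEnum_image {P : (Fin 18 → F4) → Prop} {σ : Equiv.Perm (Fin 18)} (hσ : σ ∈ coordAut P)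
    (z : Finset (Fin 18)) : avoidEnum P (z.image σ) = avoidEnum P z := by
  refine Finset.sum_nbij' (fun c => c ∘ σ) (fun c => c ∘ ⇑σ⁻¹) ?_ ?_ ?_ ?_ ?_
  · intro c hc
    simp only [Finset.mem_filter, Finset.mem_univ, true_and, Finset.forall_mem_image] at hc ⊢
    exact ⟨hσ c hc.1, fun i hi => hc.2 hi⟩
  · intro c hc
    simp only [Finset.mem_filter, Finset.mem_univ, true_and, Finset.forall_mem_image] at hc ⊢
    exact ⟨inv_mem hσ c hc.1, fun i hi => by simpa using hc.2 i hi⟩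
  · intro c _
    ext i
    simp
  · intro c _
    ext i
    simp
  · intro c _
    rw [wt_comp_perm]

theorem avoidEnum_isWord (b : Bool) :
    avoidEnum (IsWord b) {17, 0, 1} = ∑ w ∈ Finset.range 19, (weightCount b).getD w 0 •
      (MvPolynomial.X 0 ^ (18 - w) * MvPolynomial.X 1 ^ w) ∧
    avoidEnum (IsWord b) {17, 0, 3} = ∑ w ∈ Finset.range 19, (weightCount !b).getD w 0 •
      (MvPolynomial.X 0 ^ (18 - w) * MvPolynomial.X 1 ^ w) := by
  have h (k : Fin 18) (hk : k = 1 ∨ k = 3) := (sum_wt_isWord_avoiding b hk fun w =>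
    (MvPolynomial.X 0 ^ (18 - w) * MvPolynomial.X 1 ^ w : MvPolynomial (Fin 2) ℝ)).trans
      (sum_unionWeights b k _)
  refine ⟨(h 1 (.inl rfl)).trans ?_, (h 3 (.inr rfl)).trans ?_⟩
  · exact Finset.sum_congr rfl fun w hw => by
      rw [← (count_unionWeights b w (Finset.mem_range.1 hw)).1]; rfl
  · exact Finset.sum_congr rfl fun w hw => by
      rw [← (count_unionWeights b w (Finset.mem_range.1 hw)).2]; rfl

/-- The weight enumerator of a harmonic function in terms of the codewords vanishing on triples. -/
theorem sum_harmonic_eq (P : (Fin 18 → F4) → Prop) {f : Finset (Fin 18) → ℝ}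
    (hf : ∀ y : Finset (Fin 18), y.card = 2 → ∑ z with z.card = 3 ∧ y ⊆ z, f z = 0) :
    ∑ c with P c, MvPolynomial.C (∑ z ∈ (supp c).powersetCard 3, f z) *
        MvPolynomial.X 0 ^ (18 - wt c) * MvPolynomial.X 1 ^ wt c =
      -∑ z with z.card = 3, f z • avoidEnum P z := by
  simp only [sum_powersetCard_eq_neg_sum_disjoint hf, map_neg, neg_mul, Finset.sum_neg_distrib,
    map_sum, Finset.sum_mul, avoidEnum, Finset.smul_sum, MvPolynomial.smul_eq_C_mul]
  congr 1
  refine (Finset.sum_comm' fun c z => ?_).trans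
    (Finset.sum_congr rfl fun z _ => Finset.sum_congr rfl fun c _ => mul_assoc _ _ _)
  simp only [Finset.mem_filter, Finset.mem_univ, true_and, supp, Finset.disjoint_left, not_not]
  tauto

open MvPolynomial in
/-- Harmonic weight enumerator of the extended quaternary quadratic residue code `C` of
length 18: for every degree-3 harmonic function `f` (on 3-element subsets of the
coordinates, extended by `f̃(u) = ∑_{z ⊆ u, |z| = 3} f z`) that is fixed by the action of
every automorphism of `C`, there is a constant `c_f` with
`w_{C,f}(x,y) = ∑_{c ∈ C} f̃(supp c) x^(18 - wt c) y^(wt c)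
  = c_f (−1224 x¹²y⁶ + 3672 x¹⁰y⁸ − 14688 x⁹y⁹ + 3672 x⁸y¹⁰ + 51408 x⁷y¹¹ − 52632 x⁶y¹²
    + 7344 x⁴y¹⁴ + 2448 x³y¹⁵)`. -/
theorem quaternary_harmonic_weight_enumerator (K : Type) [Field K] [Algebra F4 K] (α : K)
    (hα : IsPrimitiveRoot α 17) (f : Finset (Fin 18) → ℝ)
    (hharm : ∀ y : Finset (Fin 18), y.card = 2 →
      ∑ z ∈ Finset.univ.filter (fun z : Finset (Fin 18) => z.card = 3 ∧ y ⊆ z), f z = 0)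
    (hinv : ∀ σ : Equiv.Perm (Fin 18),
      (∀ c : Fin 18 → F4, extQR4Mem α c → extQR4Mem α (c ∘ σ)) →
      ∀ z : Finset (Fin 18), z.card = 3 → f (z.image ⇑σ⁻¹) = f z) :
    ∃ cf : ℝ,
      (∑ c ∈ Finset.univ.filter (fun c : Fin 18 → F4 => extQR4Mem α c),
          MvPolynomial.C (∑ z ∈ (supp c).powersetCard 3, f z) * X 0 ^ (18 - wt c) * X 1 ^ wt c
        : MvPolynomial (Fin 2) ℝ) =
      MvPolynomial.C cf *
        (MvPolynomial.C (-1224 : ℝ) * X 0 ^ 12 * X 1 ^ 6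
          + MvPolynomial.C (3672 : ℝ) * X 0 ^ 10 * X 1 ^ 8
          + MvPolynomial.C (-14688 : ℝ) * X 0 ^ 9 * X 1 ^ 9
          + MvPolynomial.C (3672 : ℝ) * X 0 ^ 8 * X 1 ^ 10
          + MvPolynomial.C (51408 : ℝ) * X 0 ^ 7 * X 1 ^ 11
          + MvPolynomial.C (-52632 : ℝ) * X 0 ^ 6 * X 1 ^ 12
          + MvPolynomial.C (7344 : ℝ) * X 0 ^ 4 * X 1 ^ 14
          + MvPolynomial.C (2448 : ℝ) * X 0 ^ 3 * X 1 ^ 15) := by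
  obtain ⟨b, hb⟩ := extQR4Mem_iff_isWord hα
  have hP : extQR4Mem α = IsWord b := funext fun c => propext (hb c)
  rw [hP] at hinv ⊢
  have hs : shiftPerm ∈ coordAut (IsWord (M := F4) b) := fun c hc =>
    hc.comp_perm (genMat_shiftPerm b)
  have hd : doublePerm ∈ coordAut (IsWord (M := F4) b) := fun c hc =>
    hc.comp_perm (genMat_doublePerm b)
  have hi : invPerm ∈ coordAut (IsWord (M := F4) b) := fun c hc =>
    hc.comp_perm (genMat_invPerm b)
  have hf : ∀ σ ∈ coordAut (IsWord (M := F4) b), ∀ z : Finset (Fin 18), z.card = 3 →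
      f (z.image σ) = f z := fun σ hσ => by
    simpa using hinv σ⁻¹ (inv_mem hσ)
  have hf3 : f {17, 0, 3} = -f {17, 0, 1} := by
    have h := hharm {17, 0} (by decide)
    rw [sum_superset_pair (hf _ hd)] at h
    simp only [nsmul_eq_mul] at h
    push_cast at h
    linarith
  rw [sum_harmonic_eq _ hharm, sum_triples hs hi hd (F := fun z => f z • avoidEnum (IsWord b) z)
    fun σ hσ z hz => by rw [hf σ hσ z hz, avoidEnum_image hσ], hf3, (avoidEnum_isWord b).1,
    (avoidEnum_isWord b).2]
  refine ⟨if b then f {17, 0, 1} else -f {17, 0, 1}, ?_⟩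
  cases b
  all_goals
    simp only [weightCount, Finset.sum_range_succ, Finset.sum_range_zero, List.getD_cons_zero,
      List.getD_cons_succ, Bool.not_true, Bool.not_false, MvPolynomial.smul_eq_C_mul, map_neg,
      map_ofNat, nsmul_eq_mul, if_true, if_false, Bool.false_eq_true]
    push_cast
    ring
end
end

section
/- Let C be the extended ternary quadratic residue code of length 14 and Aut(C) its automorphism group inside S_14. The subspace Harm_3^{Aut(C)} of degree-3 harmonic functions on subsets of {1,…,14} that are fixed by every element of Aut(C) has dimension 5 over ℝ. -/
open scoped Classical

noncomputable section

/-- Membership in the ternary quadratic residue code of length 13: the codeword, viewed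
as the polynomial `∑ cᵢ Xⁱ` modulo `X ^ 13 - 1`, lies in the ideal generated by the
polynomial whose roots are `α ^ ℓ` for `ℓ` running over the nonzero squares mod 13;
equivalently (as that generator is separable and divides `X ^ 13 - 1`), the codeword
polynomial vanishes at `α ^ ℓ` for every nonzero square `ℓ` modulo 13. -/
def qr3Mem {K : Type} [Field K] [Algebra (ZMod 3) K] (α : K) (c : Fin 13 → ZMod 3) : Prop :=
  ∀ ℓ : ZMod 13, ℓ ≠ 0 → IsSquare ℓ →
    ∑ i : Fin 13, algebraMap (ZMod 3) K (c i) * α ^ (ℓ.val * (i : ℕ)) = 0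

/-- Membership in the extended ternary quadratic residue code of length 14: the first 13
coordinates form a codeword of the quadratic residue code of length 13 and the last
coordinate is minus the sum of the first 13. -/
def extQR3Mem {K : Type} [Field K] [Algebra (ZMod 3) K] (α : K) (c : Fin 14 → ZMod 3) : Prop :=
  qr3Mem α (fun i => c i.castSucc) ∧ c (Fin.last 13) = - ∑ i : Fin 13, c i.castSucc

/-- Permutation action on 3-element subsets of coordinates. -/
def permX3 {n : ℕ} (σ : Equiv.Perm (Fin n)) (z : {s : Finset (Fin n) // s.card = 3}) :
    {s : Finset (Fin n) // s.card = 3} :=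
  ⟨z.1.image σ, by rw [Finset.card_image_of_injective _ σ.injective]; exact z.2⟩

/-- The differentiation `γ : ℝX₃ → ℝX₂`, `(γ f)(y) = ∑_{z ∈ X₃, y ⊆ z} f z`. -/
def gammaLin (n : ℕ) :
    ({s : Finset (Fin n) // s.card = 3} → ℝ) →ₗ[ℝ]
      ({s : Finset (Fin n) // s.card = 2} → ℝ) :=
  LinearMap.pi fun y =>
    ∑ z ∈ Finset.univ.filter (fun z : {s : Finset (Fin n) // s.card = 3} => y.1 ⊆ z.1),
      LinearMap.proj z

/-- The colour of a pair of points of the projective line over `𝔽₁₃` (with `13` as the point at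
infinity): `0` on the diagonal, `3` for pairs involving infinity, and otherwise `1` or `2`
according to whether the difference is a square modulo 13. -/
def pairColor (i j : Fin 14) : ℕ :=
  if i.val = j.val then 0
  else if i.val = 13 then 3
  else if j.val = 13 then 3
  else if (i.val + 13 - j.val) ^ 6 % 13 = 1 then 1 else 2

/-- The entries, modulo 3, attached to the colours of `pairColor`. -/
def colorEntry (s : ZMod 3) (k : ℕ) : ZMod 3 :=
  if k = 0 then 0 else if k = 1 then s else if k = 2 then -s else 1

/-- The Paley conference matrix of order 14 modulo 3, with the Paley block scaled by `s`. -/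
def paleyConf (s : ZMod 3) : Matrix (Fin 14) (Fin 14) (ZMod 3) :=
  Matrix.of fun i j => colorEntry s (pairColor i j)

instance fact_prime_thirteen : Fact (Nat.Prime 13) := ⟨by norm_num⟩

/-- The quadratic character modulo 13, with values in `ZMod 3`. -/
def quadChar3 (a : ZMod 13) : ZMod 3 := ((quadraticChar (ZMod 13) a : ℤ) : ZMod 3)

lemma quadraticChar_thirteen (a : ZMod 13) :
    quadraticChar (ZMod 13) a = if a = 0 then 0 else if a ^ 6 = 1 then 1 else -1 := by
  revert a
  decide +kernel

lemma colorEntry_pairColor_castSucc (s : ZMod 3) (i j : ZMod 13) :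
    colorEntry s (pairColor (Fin.castSucc (n := 13) i) (Fin.castSucc (n := 13) j))
      = s * quadChar3 (i - j) := by
  unfold quadChar3
  rw [quadraticChar_thirteen]
  revert s i j
  decide +kernel

lemma paleyConf_transpose (s : ZMod 3) : (paleyConf s).transpose = paleyConf s := by
  revert s
  decide +kernel

lemma paleyConf_mul_self {s : ZMod 3} (hs : s = 1 ∨ s = -1) : paleyConf s * paleyConf s = 1 := by
  rcases hs with rfl | rfl <;> decide +kernel

/-- The discrete Fourier transform over `ℤ/13` of a ternary function. -/
def ternaryDFT {K : Type} [Field K] [Algebra (ZMod 3) K] (ψ : AddChar (ZMod 13) K)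
    (c : ZMod 13 → ZMod 3) (l : ZMod 13) : K :=
  ∑ i, algebraMap (ZMod 3) K (c i) * ψ (l * i)

section DFT

variable {K : Type} [Field K] [Algebra (ZMod 3) K] {ψ : AddChar (ZMod 13) K}

variable (K) in
lemma thirteen_eq_one_of_algebra : (13 : K) = 1 := by
  have h : (13 : ZMod 3) = 1 := by decide
  rw [← map_ofNat (algebraMap (ZMod 3) K), h, map_one]

lemma eq_zero_of_ternaryDFT_eq_zero (hψ : ψ.IsPrimitive) {c : ZMod 13 → ZMod 3}
    (h : ∀ l, ternaryDFT ψ c l = 0) : c = 0 := by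
  funext j
  have h1 : ∑ l, ternaryDFT ψ c l * ψ (-(l * j)) = algebraMap (ZMod 3) K (c j) := by
    calc ∑ l, ternaryDFT ψ c l * ψ (-(l * j))
        = ∑ i, algebraMap (ZMod 3) K (c i) * ∑ l, ψ (l * (i - j)) := by
          simp only [ternaryDFT, Finset.sum_mul, Finset.mul_sum]
          rw [Finset.sum_comm]
          refine Finset.sum_congr rfl fun i _ => Finset.sum_congr rfl fun l _ => ?_
          rw [mul_assoc, ← AddChar.map_add_eq_mul, mul_sub, sub_eq_add_neg]
      _ = _ := by
          simp only [AddChar.sum_mulShift _ hψ, ZMod.card, sub_eq_zero]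
          simp [thirteen_eq_one_of_algebra]
  simp only [h, zero_mul, Finset.sum_const_zero] at h1
  exact (algebraMap (ZMod 3) K).injective (by rw [← h1]; simp)

lemma ternaryDFT_add (c d : ZMod 13 → ZMod 3) (l : ZMod 13) :
    ternaryDFT ψ (c + d) l = ternaryDFT ψ c l + ternaryDFT ψ d l := by
  simp [ternaryDFT, add_mul, Finset.sum_add_distrib]

lemma ternaryDFT_smul (s : ZMod 3) (c : ZMod 13 → ZMod 3) (l : ZMod 13) :
    ternaryDFT ψ (s • c) l = algebraMap (ZMod 3) K s * ternaryDFT ψ c l := by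
  simp [ternaryDFT, Finset.mul_sum, mul_assoc]

lemma ternaryDFT_const (hψ : ψ.IsPrimitive) (v : ZMod 3) (l : ZMod 13) :
    ternaryDFT ψ (fun _ => v) l = if l = 0 then algebraMap (ZMod 3) K v else 0 := by
  have h := AddChar.sum_mulShift l hψ
  simp only [ZMod.card] at h
  simp only [ternaryDFT, ← Finset.mul_sum, mul_comm l, h]
  split_ifs <;> simp [thirteen_eq_one_of_algebra]

lemma ternaryDFT_convolution (q c : ZMod 13 → ZMod 3) (l : ZMod 13) :
    ternaryDFT ψ (fun i => ∑ j, q (i - j) * c j) l = ternaryDFT ψ q l * ternaryDFT ψ c l := by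
  calc ternaryDFT ψ (fun i => ∑ j, q (i - j) * c j) l
      = ∑ j, ∑ i, (algebraMap (ZMod 3) K (q (i - j)) * ψ (l * (i - j)))
          * (algebraMap (ZMod 3) K (c j) * ψ (l * j)) := by
        simp only [ternaryDFT, map_sum, map_mul, Finset.sum_mul]
        rw [Finset.sum_comm]
        refine Finset.sum_congr rfl fun j _ => Finset.sum_congr rfl fun i _ => ?_
        rw [mul_mul_mul_comm, ← AddChar.map_add_eq_mul, ← mul_add, sub_add_cancel]
    _ = _ := by
        rw [ternaryDFT, ternaryDFT, Finset.mul_sum]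
        refine Finset.sum_congr rfl fun j _ => ?_
        rw [← Finset.sum_mul]
        congr 1
        exact Equiv.sum_comp (Equiv.subRight j)
          fun k => algebraMap (ZMod 3) K (q k) * ψ (l * k)

variable (K) in
/-- The quadratic character modulo 13 with values in an `𝔽₃`-algebra. -/
def quadCharAlg : MulChar (ZMod 13) K :=
  (quadraticChar (ZMod 13)).ringHomComp (Int.castRingHom K)

lemma algebraMap_quadChar3 (a : ZMod 13) :
    algebraMap (ZMod 3) K (quadChar3 a) = quadCharAlg K a := by
  simp [quadChar3, quadCharAlg]

variable (K) in
lemma neg_one_ne_one_of_algebra : (-1 : K) ≠ 1 := by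
  intro h
  have h2 : (-1 : ZMod 3) = 1 := (algebraMap (ZMod 3) K).injective (by simpa using h)
  exact absurd h2 (by decide)

lemma quadCharAlg_ne_one : quadCharAlg K ≠ 1 := by
  intro h
  have h2 : quadCharAlg K 2 = 1 := by
    rw [h]
    exact MulChar.one_apply_coe (Units.mk0 (2 : ZMod 13) (by decide))
  have h3 : quadraticChar (ZMod 13) 2 = -1 := by
    rw [quadraticChar_thirteen]
    decide
  simp only [quadCharAlg, MulChar.ringHomComp_apply, h3] at h2
  exact neg_one_ne_one_of_algebra K (by simpa using h2)

lemma ternaryDFT_quadChar3_one : ternaryDFT ψ quadChar3 1 = gaussSum (quadCharAlg K) ψ := by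
  simp [ternaryDFT, gaussSum, algebraMap_quadChar3]

lemma ternaryDFT_quadChar3_sq (hψ : ψ.IsPrimitive) : ternaryDFT ψ quadChar3 1 ^ 2 = 1 := by
  have hq : (quadCharAlg K).IsQuadratic := (quadraticChar_isQuadratic (ZMod 13)).comp _
  have h1 : quadraticChar (ZMod 13) (-1) = 1 := by
    rw [quadraticChar_thirteen]
    decide
  rw [ternaryDFT_quadChar3_one, gaussSum_sq quadCharAlg_ne_one hq hψ, ZMod.card,
    Nat.cast_ofNat, thirteen_eq_one_of_algebra, mul_one]
  simp [quadCharAlg, h1]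

lemma ternaryDFT_quadChar3 (l : ZMod 13) :
    ternaryDFT ψ quadChar3 l = algebraMap (ZMod 3) K (quadChar3 l) * ternaryDFT ψ quadChar3 1 := by
  have hq : (quadCharAlg K).IsQuadratic := (quadraticChar_isQuadratic (ZMod 13)).comp _
  rw [ternaryDFT_quadChar3_one, algebraMap_quadChar3]
  by_cases hl : l = 0
  · subst hl
    have h := MulChar.sum_eq_zero_of_ne_one (quadCharAlg_ne_one (K := K))
    simp [ternaryDFT, algebraMap_quadChar3, h, (quadCharAlg K).map_nonunit not_isUnit_zero]
  · have h := gaussSum_mulShift_eq (quadCharAlg K) ψ (Units.mk0 l hl)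
    rw [hq.inv, Units.val_mk0] at h
    rw [← h]
    simp [ternaryDFT, gaussSum, algebraMap_quadChar3]

end DFT

lemma qr3Mem_iff {K : Type} [Field K] [Algebra (ZMod 3) K] {α : K}
    (hα : α ^ 13 = 1) (c : ZMod 13 → ZMod 3) :
    qr3Mem α c ↔ ∀ l : ZMod 13, l ≠ 0 → IsSquare l →
      ternaryDFT (AddChar.zmodChar 13 hα) c l = 0 := by
  refine forall_congr' fun l => imp_congr_right fun _ => imp_congr_right fun _ => ?_
  refine Eq.congr ?_ rfl
  refine Finset.sum_congr rfl fun i _ => ?_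
  congr 1
  have h : ∀ j : ZMod 13, α ^ (l.val * j.val) = AddChar.zmodChar 13 hα (l * j) := fun j => by
    rw [← AddChar.zmodChar_apply' hα, Nat.cast_mul, ZMod.natCast_zmod_val, ZMod.natCast_zmod_val]
  exact h i

lemma paleyConf_mulVec_castSucc (s : ZMod 3) (c : Fin 14 → ZMod 3) (i : ZMod 13) :
    (paleyConf s).mulVec c (Fin.castSucc (n := 13) i)
      = s * ∑ j : ZMod 13, quadChar3 (i - j) * c (Fin.castSucc (n := 13) j)
        + c (Fin.last 13) := by
  have h : colorEntry s (pairColor (Fin.castSucc (n := 13) i) (Fin.last 13)) = 1 := by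
    revert s i
    decide +kernel
  rw [Matrix.mulVec, dotProduct, Fin.sum_univ_castSucc, Finset.mul_sum]
  simp only [paleyConf, Matrix.of_apply]
  rw [h, one_mul]
  refine congrArg (· + c (Fin.last 13)) ?_
  refine Finset.sum_congr rfl fun j _ => ?_
  rw [colorEntry_pairColor_castSucc s i j, mul_assoc]

lemma paleyConf_mulVec_last (s : ZMod 3) (c : Fin 14 → ZMod 3) :
    (paleyConf s).mulVec c (Fin.last 13) = ∑ i : Fin 13, c i.castSucc := by
  have h : ∀ i : Fin 13, colorEntry s (pairColor (Fin.last 13) i.castSucc) = 1 := by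
    revert s
    decide
  have h2 : colorEntry s (pairColor (Fin.last 13) (Fin.last 13)) = 0 := by
    revert s
    decide
  rw [Matrix.mulVec, dotProduct, Fin.sum_univ_castSucc]
  simp only [paleyConf, Matrix.of_apply, h, h2, one_mul, zero_mul, add_zero]

lemma exists_extQR3Mem_iff {K : Type} [Field K] [Algebra (ZMod 3) K] {α : K}
    (hα : IsPrimitiveRoot α 13) :
    ∃ s : ZMod 3, (s = 1 ∨ s = -1) ∧
      ∀ c, extQR3Mem α c ↔ (paleyConf s).mulVec c = -c := by
  set ψ := AddChar.zmodChar 13 hα.pow_eq_one with hψdef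
  have hψ : ψ.IsPrimitive := AddChar.zmodChar_primitive_of_primitive_root 13 hα
  obtain ⟨s, hs, hg⟩ : ∃ s : ZMod 3, (s = 1 ∨ s = -1) ∧
      algebraMap (ZMod 3) K s = ternaryDFT ψ quadChar3 1 := by
    rcases sq_eq_one_iff.1 (ternaryDFT_quadChar3_sq hψ) with h | h
    · exact ⟨1, Or.inl rfl, by rw [h, map_one]⟩
    · exact ⟨-1, Or.inr rfl, by rw [h, map_neg, map_one]⟩
  have hg2 := ternaryDFT_quadChar3_sq hψ
  refine ⟨s, hs, fun c => ?_⟩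
  set d : ZMod 13 → ZMod 3 := fun i => c (Fin.castSucc (n := 13) i) with hd
  set w : ZMod 13 → ZMod 3 :=
    d + ((s • fun a : ZMod 13 => ∑ j : ZMod 13, quadChar3 (a - j) * d j)
      + fun _ => c (Fin.last 13)) with hw
  have hDFT : ∀ l, ternaryDFT ψ w l
      = ternaryDFT ψ d l * (1 + algebraMap (ZMod 3) K (quadChar3 l))
        + if l = 0 then algebraMap (ZMod 3) K (c (Fin.last 13)) else 0 := by
    intro l
    rw [hw, ternaryDFT_add, ternaryDFT_add, ternaryDFT_smul, ternaryDFT_convolution,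
      ternaryDFT_const hψ, ternaryDFT_quadChar3, hg]
    linear_combination
      (ternaryDFT ψ d l * algebraMap (ZMod 3) K (quadChar3 l)) * hg2
  have hmul : (paleyConf s).mulVec c = -c ↔
      w = 0 ∧ c (Fin.last 13) = -∑ i : Fin 13, c i.castSucc := by
    constructor
    · intro h
      refine ⟨funext fun i => ?_, ?_⟩
      · have := congrFun h (Fin.castSucc (n := 13) i)
        rw [paleyConf_mulVec_castSucc] at this
        exact (congrArg (d i + ·) this).trans (add_neg_cancel _)
      · have := congrFun h (Fin.last 13)
        rw [paleyConf_mulVec_last] at this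
        rw [this]
        simp
    · rintro ⟨h1, h2⟩
      funext i
      refine Fin.lastCases ?_ (fun i => ?_) i
      · rw [paleyConf_mulVec_last, Pi.neg_apply, h2, neg_neg]
      · refine (paleyConf_mulVec_castSucc s c i).trans ?_
        exact eq_neg_of_add_eq_zero_right (congrFun h1 i)
  rw [hmul, extQR3Mem]
  refine and_congr_left fun hlast => ?_
  rw [show (fun i : Fin 13 => c i.castSucc) = d from rfl, qr3Mem_iff hα.pow_eq_one]
  constructor
  · intro h
    refine eq_zero_of_ternaryDFT_eq_zero hψ fun l => ?_
    rw [hDFT]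
    by_cases hl : l = 0
    · subst hl
      have h0 : quadChar3 0 = 0 := by simp [quadChar3]
      have h1 : ternaryDFT ψ d 0 = algebraMap (ZMod 3) K (∑ i : Fin 13, c i.castSucc) := by
        simp only [ternaryDFT, zero_mul, AddChar.map_zero_eq_one, mul_one, map_sum]
        rfl
      rw [if_pos rfl, h0, h1, hlast]
      simp
    · rw [if_neg hl, add_zero]
      by_cases hsq : IsSquare l
      · rw [h l hl hsq, zero_mul]
      · have h1 : quadChar3 l = -1 := by
          simp [quadChar3, quadraticChar_neg_one_iff_not_isSquare.2 hsq]
        simp [h1]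
  · intro h l hl hsq
    have h1 : quadChar3 l = 1 := by
      simp [quadChar3, (quadraticChar_one_iff_isSquare hl).2 hsq]
    have h2 := hDFT l
    rw [h, if_neg hl, h1, map_one, add_zero] at h2
    have h3 : (1 : K) + 1 ≠ 0 := fun h4 => neg_one_ne_one_of_algebra K
      (neg_eq_of_add_eq_zero_left h4)
    have h4 : ternaryDFT ψ (0 : ZMod 13 → ZMod 3) l = 0 := by simp [ternaryDFT]
    rw [h4] at h2
    exact (mul_eq_zero.1 h2.symm).resolve_right h3

section Automorphisms

variable {n : ℕ} {S : Matrix (Fin n) (Fin n) (ZMod 3)}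

lemma mul_one_sub_submatrix (hS : S * S = 1) {σ : Equiv.Perm (Fin n)}
    (h : ∀ c, S.mulVec c = -c → S.mulVec (c ∘ σ) = -(c ∘ σ)) :
    S * (1 - S.submatrix σ σ) = -(1 - S.submatrix σ σ) := by
  have h1 : S * (1 - S) = -(1 - S) := by rw [mul_sub, hS]; simp
  have h2 : 1 - S.submatrix σ σ = (1 - S).submatrix σ σ := by
    rw [Matrix.submatrix_sub, Pi.sub_apply, Pi.sub_apply, Matrix.submatrix_one_equiv]
  rw [h2]
  ext i k
  have h3 := h (fun j => (1 - S) j (σ k)) (by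
    ext j
    exact congrFun (congrFun h1 j) (σ k))
  exact congrFun h3 i

lemma preserves_negEigenspace_iff (hS : S * S = 1) (hT : S.transpose = S)
    {σ : Equiv.Perm (Fin n)} :
    (∀ c, S.mulVec c = -c → S.mulVec (c ∘ σ) = -(c ∘ σ)) ↔
      ∀ i j, S (σ i) (σ j) = S i j := by
  constructor
  · intro h
    have hpow : ∀ m : ℕ, ∀ c, S.mulVec c = -c →
        S.mulVec (c ∘ (σ ^ m : Equiv.Perm (Fin n))) = -(c ∘ (σ ^ m : Equiv.Perm (Fin n))) := by
      intro m
      induction m with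
      | zero => exact fun c hc => hc
      | succ m ih =>
        intro c hc
        rw [pow_succ]
        exact h _ (ih c hc)
    obtain ⟨m, hm⟩ : ∃ m : ℕ, σ ^ m = σ⁻¹ :=
      mem_powers_iff_mem_zpowers.2 (inv_mem (Subgroup.mem_zpowers σ))
    have h1 := mul_one_sub_submatrix hS h
    have h2 := mul_one_sub_submatrix hS (hpow m)
    rw [hm] at h2
    have h3 := congrArg (fun M => M.submatrix σ σ) h2
    have h4 : (1 - S.submatrix (σ⁻¹ : Equiv.Perm (Fin n))
        (σ⁻¹ : Equiv.Perm (Fin n))).submatrix σ σ = 1 - S := by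
      ext i j
      simp [Matrix.one_apply, Matrix.submatrix_apply]
    have h5 : S.submatrix σ σ * (1 - S) = -(1 - S) := by
      rw [← h4, Matrix.submatrix_mul_equiv]
      exact h3
    have h6 := congrArg Matrix.transpose h5
    have hT' : (S.submatrix σ σ).transpose = S.submatrix σ σ := by
      rw [Matrix.transpose_submatrix, hT]
    rw [Matrix.transpose_mul, Matrix.transpose_neg, Matrix.transpose_sub, hT,
      Matrix.transpose_one, hT'] at h6
    have h7 : S.submatrix σ σ - S = S - S.submatrix σ σ := by
      have h8 : S - S * S.submatrix σ σ = S.submatrix σ σ - 1 := by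
        rw [mul_sub, mul_one] at h1
        rw [h1, neg_sub]
      have h9 : S.submatrix σ σ - S * S.submatrix σ σ = S - 1 := by
        rw [sub_mul, one_mul] at h6
        rw [h6, neg_sub]
      calc S.submatrix σ σ - S = (S.submatrix σ σ - S * S.submatrix σ σ)
            - (S - S * S.submatrix σ σ) := by abel
        _ = _ := by rw [h8, h9]; abel
    intro i j
    have h8 : S (σ i) (σ j) - S i j = S i j - S (σ i) (σ j) := congrFun (congrFun h7 i) j
    have : ∀ a b : ZMod 3, a - b = b - a → a = b := by decide
    exact this _ _ h8
  · intro h c hc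
    ext i
    have h1 := congrFun hc (σ i)
    simp only [Pi.neg_apply, Function.comp_apply, Matrix.mulVec, dotProduct] at h1 ⊢
    rw [← h1]
    exact Fintype.sum_equiv σ _ _ fun j => by rw [h]

end Automorphisms

lemma paleyConf_invariant_iff {s : ZMod 3} (hs : s = 1 ∨ s = -1) (σ : Equiv.Perm (Fin 14)) :
    (∀ i j, paleyConf s (σ i) (σ j) = paleyConf s i j) ↔
      ∀ i j, pairColor (σ i) (σ j) = pairColor i j := by
  constructor
  · intro h
    have h1 : ∀ k, paleyConf s (Fin.last 13) k ≠ -1 := by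
      rcases hs with rfl | rfl <;> decide
    obtain ⟨d, h2⟩ : ∃ d : Fin 13, ∀ i : Fin 13,
        paleyConf s i.castSucc (i + d).castSucc = -1 := by
      rcases hs with rfl | rfl
      exacts [⟨2, by decide +kernel⟩, ⟨1, by decide +kernel⟩]
    have h3 : ∀ i j, pairColor i j = if i = j then 0 else
        if i = Fin.last 13 ∨ j = Fin.last 13 then 3 else if paleyConf s i j = s then 1 else 2 := by
      rcases hs with rfl | rfl <;> decide +kernel
    have h4 : σ (Fin.last 13) = Fin.last 13 := by
      by_contra hne
      obtain ⟨i, hi⟩ := Fin.exists_castSucc_eq.2 hne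
      have hd := h2 i
      rw [hi, ← σ.apply_symm_apply (i + d).castSucc, h] at hd
      exact h1 _ hd
    have h5 : ∀ i, σ i = Fin.last 13 ↔ i = Fin.last 13 := fun i => by
      rw [← σ.injective.eq_iff (a := i), h4]
    intro i j
    rw [h3, h3 i j]
    simp only [h i j, h5, σ.injective.eq_iff]
  · intro h i j
    simp only [paleyConf, Matrix.of_apply, h]

/-- A cubic moment of the colours seen from a set of points; it is invariant under all
colour-preserving permutations and separates their orbits on triples. -/
def colorMoment (z : Finset (Fin 14)) : ℕ := ∑ v, (∑ i ∈ z, pairColor v i) ^ 3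

lemma colorMoment_image {σ : Equiv.Perm (Fin 14)}
    (h : ∀ i j, pairColor (σ i) (σ j) = pairColor i j) (z : Finset (Fin 14)) :
    colorMoment (z.image σ) = colorMoment z := by
  unfold colorMoment
  rw [← Equiv.sum_comp σ]
  simp only [Finset.sum_image σ.injective.injOn, h]

/-- The index of the orbit with a given value of `colorMoment`. -/
def momentIndex (m : ℕ) : Fin 8 :=
  if m = 1857 then 0 else if m = 1851 then 1 else if m = 1911 then 2 else if m = 1785 then 3
  else if m = 1779 then 4 else if m = 2919 then 5 else if m = 1707 then 6 else 7

/-- Representatives of the orbits on triples. -/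
def orbitRep : Fin 8 → Finset (Fin 14) :=
  ![{0, 1, 2}, {0, 1, 3}, {0, 1, 4}, {0, 1, 6}, {0, 1, 7}, {0, 1, 13}, {0, 2, 7}, {0, 2, 13}]

lemma card_orbitRep (k : Fin 8) : (orbitRep k).card = 3 := by
  revert k
  decide

lemma momentIndex_orbitRep (k : Fin 8) : momentIndex (colorMoment (orbitRep k)) = k := by
  revert k
  decide +kernel

/-- The affine map `x ↦ a ^ 2 * x + b` of the projective line over `𝔽₁₃`. -/
def squareAffine (a b : Fin 13) (x : Fin 14) : Fin 14 :=
  if x.val = 13 then 13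
  else ⟨(a.val ^ 2 * x.val + b.val) % 13, (Nat.mod_lt _ (by norm_num)).trans (by norm_num)⟩

set_option maxRecDepth 100000 in
lemma pairColor_squareAffine : ∀ a : Fin 13, a ≠ 0 → ∀ b : Fin 13, ∀ i j : Fin 14,
    pairColor (squareAffine a b i) (squareAffine a b j) = pairColor i j := by
  decide +kernel

lemma squareAffine_injective {a : Fin 13} (ha : a ≠ 0) (b : Fin 13) :
    Function.Injective (squareAffine a b) := by
  intro i j hij
  have h0 : ∀ i j, pairColor i j = 0 ↔ i = j := by decide +kernel
  rw [← h0, ← pairColor_squareAffine a ha b, h0, hij]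

lemma exists_squareAffine_mem_orbitRep : ∀ i j : Fin 14, i < j → ∀ k, j < k →
    ∃ a : Fin 13, a ≠ 0 ∧ ∃ b : Fin 13,
      squareAffine a b i ∈ orbitRep (momentIndex (colorMoment {i, j, k})) ∧
      squareAffine a b j ∈ orbitRep (momentIndex (colorMoment {i, j, k})) ∧
      squareAffine a b k ∈ orbitRep (momentIndex (colorMoment {i, j, k})) := by
  decide +kernel

/-- The orbit of a pair of distinct points, read off from its colour. -/
def pairOrbit (i j : Fin 14) : Fin 3 :=
  if pairColor i j = 1 then 0 else if pairColor i j = 2 then 1 else 2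

/-- The number of triples of each orbit that contain a given pair, for the three orbits
on pairs. -/
def pairTripleCount : Matrix (Fin 3) (Fin 8) ℕ :=
  !![2, 4, 2, 2, 1, 1, 0, 0; 1, 2, 0, 4, 2, 0, 2, 1; 0, 0, 0, 0, 0, 6, 0, 6]

lemma card_filter_momentIndex : ∀ i j : Fin 14, i < j → ∀ k : Fin 8,
    ((Finset.univ \ {i, j}).filter fun x : Fin 14 =>
      momentIndex (colorMoment {x, i, j}) = k).card = pairTripleCount (pairOrbit i j) k := by
  decide +kernel

/-- The index of the orbit of a triple. -/
def tripleOrbit (z : {s : Finset (Fin 14) // s.card = 3}) : Fin 8 := momentIndex (colorMoment z.1)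

/-- The representative triple of an orbit. -/
def orbitRepX3 (k : Fin 8) : {s : Finset (Fin 14) // s.card = 3} := ⟨orbitRep k, card_orbitRep k⟩

lemma tripleOrbit_orbitRepX3 (k : Fin 8) : tripleOrbit (orbitRepX3 k) = k :=
  momentIndex_orbitRep k

lemma exists_lt_lt_of_card_eq_three {n : ℕ} {z : Finset (Fin n)} (hz : z.card = 3) :
    ∃ i j k, i < j ∧ j < k ∧ z = {i, j, k} := by
  refine ⟨z.orderEmbOfFin hz 0, z.orderEmbOfFin hz 1, z.orderEmbOfFin hz 2,
    (z.orderEmbOfFin hz).strictMono (by decide), (z.orderEmbOfFin hz).strictMono (by decide), ?_⟩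
  rw [← Finset.coe_inj, ← Finset.range_orderEmbOfFin z hz]
  ext x
  simp only [Set.mem_range, Fin.exists_fin_succ, Finset.coe_insert, Finset.coe_singleton,
    Set.mem_insert_iff, Set.mem_singleton_iff, eq_comm (a := x), IsEmpty.exists_iff, or_false]
  rfl

lemma exists_lt_of_card_eq_two {n : ℕ} {y : Finset (Fin n)} (hy : y.card = 2) :
    ∃ i j, i < j ∧ y = {i, j} := by
  obtain ⟨i, j, hij, rfl⟩ := Finset.card_eq_two.1 hy
  rcases hij.lt_or_gt with h | h
  · exact ⟨i, j, h, rfl⟩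
  · exact ⟨j, i, h, Finset.pair_comm i j⟩

lemma exists_permX3_eq_orbitRepX3 (z : {s : Finset (Fin 14) // s.card = 3}) :
    ∃ σ : Equiv.Perm (Fin 14), (∀ i j, pairColor (σ i) (σ j) = pairColor i j) ∧
      permX3 σ z = orbitRepX3 (tripleOrbit z) := by
  obtain ⟨z, hz⟩ := z
  obtain ⟨i, j, k, hij, hjk, rfl⟩ := exists_lt_lt_of_card_eq_three hz
  obtain ⟨a, ha, b, h⟩ := exists_squareAffine_mem_orbitRep i j hij k hjk
  obtain ⟨σ, hσ⟩ : ∃ σ : Equiv.Perm (Fin 14), ∀ x, σ x = squareAffine a b x :=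
    ⟨Equiv.ofBijective _ (Finite.injective_iff_bijective.1 (squareAffine_injective ha b)),
      fun _ => rfl⟩
  simp only [← hσ] at h
  refine ⟨σ, fun x y => by rw [hσ, hσ, pairColor_squareAffine a ha b],
    Subtype.ext (Finset.eq_of_subset_of_card_le ?_ ?_)⟩
  · simp only [permX3, Finset.image_insert, Finset.image_singleton, Finset.insert_subset_iff,
      Finset.singleton_subset_iff]
    exact h
  · rw [(orbitRepX3 _).2, (permX3 _ _).2]

lemma permX3_inv_permX3 {n : ℕ} (σ : Equiv.Perm (Fin n)) (z : {s : Finset (Fin n) // s.card = 3}) :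
    permX3 σ⁻¹ (permX3 σ z) = z := by
  apply Subtype.ext
  simp [permX3, Finset.image_image]

lemma comp_permX3_inv_eq_iff (f : {s : Finset (Fin 14) // s.card = 3} → ℝ) :
    (∀ σ : Equiv.Perm (Fin 14), (∀ i j, pairColor (σ i) (σ j) = pairColor i j) →
      f ∘ permX3 σ⁻¹ = f) ↔ ∃ F : Fin 8 → ℝ, F ∘ tripleOrbit = f := by
  constructor
  · intro h
    refine ⟨f ∘ orbitRepX3, funext fun z => ?_⟩
    obtain ⟨σ, hσ, hz⟩ := exists_permX3_eq_orbitRepX3 z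
    have h1 := congrFun (h σ hσ) (permX3 σ z)
    rw [Function.comp_apply, permX3_inv_permX3] at h1
    rw [Function.comp_apply, Function.comp_apply, ← hz, h1]
  · rintro ⟨F, rfl⟩ σ hσ
    have hσ' : ∀ i j, pairColor (σ⁻¹ i) (σ⁻¹ j) = pairColor i j := fun i j => by
      rw [← hσ]; simp
    funext z
    simp only [Function.comp_apply, tripleOrbit, permX3, colorMoment_image hσ']

lemma gammaLin_comp_val {n : ℕ} (h : Finset (Fin n) → ℝ)
    (y : {s : Finset (Fin n) // s.card = 2}) :
    gammaLin n (fun z => h z.1) y = ∑ x ∈ Finset.univ \ y.1, h (insert x y.1) := by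
  simp only [gammaLin, LinearMap.pi_apply, LinearMap.sum_apply, LinearMap.proj_apply]
  symm
  refine Finset.sum_bij (fun x hx => ⟨insert x y.1, by
    rw [Finset.card_insert_of_notMem (Finset.mem_sdiff.1 hx).2, y.2]⟩) ?_ ?_ ?_ ?_
  · intro x _
    simp
  · intro x hx x' hx' he
    exact (Finset.insert_inj (Finset.mem_sdiff.1 hx).2).1 (congrArg Subtype.val he)
  · intro z hz
    obtain ⟨x, hx, he⟩ := Finset.exists_eq_insert_iff.2
      ⟨(Finset.mem_filter.1 hz).2, show y.1.card + 1 = z.1.card by rw [y.2, z.2]⟩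
    exact ⟨x, by simpa using hx, Subtype.ext he⟩
  · intro x _
    rfl

/-- The restriction of `gammaLin 14` to invariant functions, in orbit coordinates. -/
def orbitGamma : (Fin 8 → ℝ) →ₗ[ℝ] (Fin 3 → ℝ) :=
  (pairTripleCount.map (Nat.cast : ℕ → ℝ)).mulVecLin

lemma gammaLin_comp_tripleOrbit (F : Fin 8 → ℝ) {i j : Fin 14} (hij : i < j)
    (h : ({i, j} : Finset (Fin 14)).card = 2) :
    gammaLin 14 (F ∘ tripleOrbit) ⟨{i, j}, h⟩ = orbitGamma F (pairOrbit i j) := by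
  have h1 := gammaLin_comp_val (fun z => F (momentIndex (colorMoment z))) ⟨{i, j}, h⟩
  refine h1.trans ?_
  rw [← Finset.sum_fiberwise _ (fun x => momentIndex (colorMoment (insert x {i, j})))]
  simp only [orbitGamma, Matrix.mulVecLin_apply, Matrix.mulVec, dotProduct, Matrix.map_apply]
  refine Finset.sum_congr rfl fun k _ => ?_
  rw [← card_filter_momentIndex i j hij k, ← nsmul_eq_mul, ← Finset.sum_const]
  exact Finset.sum_congr rfl fun x hx => congrArg F (Finset.mem_filter.1 hx).2

lemma gammaLin_comp_tripleOrbit_eq_zero_iff (F : Fin 8 → ℝ) :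
    gammaLin 14 (F ∘ tripleOrbit) = 0 ↔ orbitGamma F = 0 := by
  constructor
  · intro h
    have h1 : ∀ i j : Fin 14, i < j → orbitGamma F (pairOrbit i j) = 0 := fun i j hij => by
      rw [← gammaLin_comp_tripleOrbit F hij (Finset.card_pair hij.ne), h, Pi.zero_apply]
    funext t
    fin_cases t
    exacts [h1 0 1 (by decide), h1 0 2 (by decide), h1 0 13 (by decide)]
  · intro h
    funext y
    obtain ⟨y, hy⟩ := y
    obtain ⟨i, j, hij, rfl⟩ := exists_lt_of_card_eq_two hy
    rw [gammaLin_comp_tripleOrbit F hij, h, Pi.zero_apply, Pi.zero_apply]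

lemma orbitGamma_surjective : Function.Surjective orbitGamma := by
  intro y
  refine ⟨![0, 0, 0, 0, y 0 - y 2 / 6, y 2 / 6, (y 1 - 2 * (y 0 - y 2 / 6)) / 2, 0], ?_⟩
  funext t
  fin_cases t <;>
    simp [orbitGamma, pairTripleCount, Matrix.mulVec, dotProduct, Fin.sum_univ_succ] <;> ring

lemma finrank_ker_orbitGamma : Module.finrank ℝ (LinearMap.ker orbitGamma) = 5 := by
  have h := LinearMap.finrank_range_add_finrank_ker orbitGamma
  rw [LinearMap.range_eq_top.2 orbitGamma_surjective, finrank_top] at h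
  simp only [Module.finrank_fintype_fun_eq_card, Fintype.card_fin] at h
  omega

lemma automorphism_iff {K : Type} [Field K] [Algebra (ZMod 3) K] {α : K}
    (hα : IsPrimitiveRoot α 13) (σ : Equiv.Perm (Fin 14)) :
    (∀ c : Fin 14 → ZMod 3, extQR3Mem α c → extQR3Mem α (c ∘ σ)) ↔
      ∀ i j, pairColor (σ i) (σ j) = pairColor i j := by
  obtain ⟨s, hs, h⟩ := exists_extQR3Mem_iff hα
  rw [← paleyConf_invariant_iff hs,
    ← preserves_negEigenspace_iff (paleyConf_mul_self hs) (paleyConf_transpose s)]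
  simp only [h]

lemma map_ker_orbitGamma {K : Type} [Field K] [Algebra (ZMod 3) K] {α : K}
    (hα : IsPrimitiveRoot α 13) :
    (LinearMap.ker orbitGamma).map (LinearMap.funLeft ℝ ℝ tripleOrbit) =
      LinearMap.ker (gammaLin 14) ⊓
        ⨅ σ ∈ {σ : Equiv.Perm (Fin 14) |
            ∀ c : Fin 14 → ZMod 3, extQR3Mem α c → extQR3Mem α (c ∘ σ)},
          LinearMap.ker (LinearMap.funLeft ℝ ℝ (permX3 σ⁻¹) - LinearMap.id) := by
  ext f
  simp only [Submodule.mem_map, Submodule.mem_inf, Submodule.mem_iInf, LinearMap.mem_ker,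
    LinearMap.sub_apply, LinearMap.id_apply, sub_eq_zero, Set.mem_ofPred_eq, automorphism_iff hα]
  have h := comp_permX3_inv_eq_iff f
  constructor
  · rintro ⟨F, hF, rfl⟩
    exact ⟨(gammaLin_comp_tripleOrbit_eq_zero_iff F).2 hF, h.2 ⟨F, rfl⟩⟩
  · rintro ⟨hf, hinv⟩
    obtain ⟨F, rfl⟩ := h.1 hinv
    exact ⟨F, (gammaLin_comp_tripleOrbit_eq_zero_iff F).1 hf, rfl⟩

/-- The space `Harm₃^{Aut(C)}` of degree-3 harmonic functions (elements of `ker γ` on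
`ℝX₃`) invariant under the automorphism group of the extended ternary quadratic residue
code `C` of length 14 has dimension 5. -/
theorem ternary_invariant_harmonic_dim (K : Type) [Field K] [Algebra (ZMod 3) K] (α : K)
    (hα : IsPrimitiveRoot α 13) :
    Module.finrank ℝ
      ↥(LinearMap.ker (gammaLin 14) ⊓
        ⨅ σ ∈ {σ : Equiv.Perm (Fin 14) |
            ∀ c : Fin 14 → ZMod 3, extQR3Mem α c → extQR3Mem α (c ∘ σ)},
          LinearMap.ker (LinearMap.funLeft ℝ ℝ (permX3 σ⁻¹) - LinearMap.id)) = 5 := by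
  rw [← map_ker_orbitGamma hα, ← finrank_ker_orbitGamma]
  exact (Submodule.equivMapOfInjective _ (LinearMap.funLeft_injective_of_surjective ℝ ℝ _
    (Function.RightInverse.surjective tripleOrbit_orbitRepX3)) _).finrank_eq.symm
end
end

section
/- Let C be the extended quaternary quadratic residue code of length 18 and Aut(C) its automorphism group inside S_18. The subspace Harm_3^{Aut(C)} of degree-3 harmonic functions on subsets of {1,…,18} that are fixed by every element of Aut(C) has dimension 1 over ℝ. -/
open scoped Classical

noncomputable section

/-- The bit in row `b` and column `i` of the binary matrix whose `i`-th column is the binary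
expansion of the `i`-th entry of `L`. -/
def checkBit (L : List ℕ) (b : ℕ) (i : Fin 18) : ℕ :=
  L.getD i 0 / 2 ^ b % 2

/-- Columns of the parity-check matrix of the extended code attached to a root of
`X ^ 8 + X ^ 5 + X ^ 4 + X ^ 3 + 1`: the low eight bits of column `i < 17` are the coefficients
of the residue of `X ^ i`, and the ninth bit is the overall parity check. -/
def checkColumns₁ : List ℕ :=
  [257, 258, 260, 264, 272, 288, 320, 384, 313, 370, 484, 497, 475, 399, 295, 334, 412, 256]

/-- The analogue of `checkColumns₁` for
`X ^ 8 + X ^ 7 + X ^ 6 + X ^ 4 + X ^ 2 + X + 1`. -/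
def checkColumns₂ : List ℕ :=
  [257, 258, 260, 264, 272, 288, 320, 384, 471, 377, 498, 307, 358, 460, 335, 414, 491, 256]

/-- The translation `i ↦ i + k` of the projective line over `𝔽₁₇`, with `17` as infinity. -/
def translation (k : Fin 17) : Equiv.Perm (Fin 18) where
  toFun i := if i = 17 then 17 else Fin.ofNat 18 ((i + k) % 17)
  invFun i := if i = 17 then 17 else Fin.ofNat 18 ((i + (17 - k)) % 17)
  left_inv := by revert k; decide
  right_inv := by revert k; decide

/-- The homothety `i ↦ 2 ^ k * i` of the projective line over `𝔽₁₇`. -/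
def homothety (k : Fin 8) : Equiv.Perm (Fin 18) where
  toFun i := if i = 17 then 17 else Fin.ofNat 18 (2 ^ (k : ℕ) * i % 17)
  invFun i := if i = 17 then 17 else Fin.ofNat 18 (2 ^ (8 - k : ℕ) * i % 17)
  left_inv := by revert k; decide
  right_inv := by revert k; decide

/-- The map `i ↦ -1 / i` of the projective line over `𝔽₁₇`. -/
def inversion : Equiv.Perm (Fin 18) where
  toFun i := if i = 17 then 0 else if i = 0 then 17 else Fin.ofNat 18 (16 * (i : ℕ) ^ 15 % 17)
  invFun i := if i = 17 then 0 else if i = 0 then 17 else Fin.ofNat 18 (16 * (i : ℕ) ^ 15 % 17)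
  left_inv := by decide
  right_inv := by decide

/-- Permuting the columns by `σ` sends each row to a combination of the rows modulo `2`; the
columns `0, …, 7, 17` are used to read off the coefficients. -/
def PreservesRows (L : List ℕ) (σ : Equiv.Perm (Fin 18)) : Prop :=
  ∀ b : Fin 9, ∀ j : Fin 18, checkBit L b (σ.symm j) ≡
    checkBit L b (σ.symm 17) * checkBit L 8 j + ∑ d : Fin 8,
      (checkBit L b (σ.symm (d.castLE (by norm_num))) + checkBit L b (σ.symm 17)) * checkBit L d j
    [MOD 2]

instance (L : List ℕ) (σ : Equiv.Perm (Fin 18)) : Decidable (PreservesRows L σ) := by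
  unfold PreservesRows Nat.ModEq; infer_instance

theorem preservesRows_translation :
    ∀ L ∈ [checkColumns₁, checkColumns₂], ∀ k, PreservesRows L (translation k) := by
  decide +kernel

theorem preservesRows_homothety :
    ∀ L ∈ [checkColumns₁, checkColumns₂], ∀ k, PreservesRows L (homothety k) := by
  decide +kernel

theorem preservesRows_inversion :
    ∀ L ∈ [checkColumns₁, checkColumns₂], PreservesRows L inversion := by
  decide +kernel

/-- The sets of three coordinates completing `z` to the support of a binary word of weight six
passing all checks of `L`. -/
def completions (L : List ℕ) (z : Finset (Fin 18)) : Finset (Finset (Fin 18)) :=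
  (Finset.powersetCard 3 Finset.univ).filter fun u =>
    Disjoint z u ∧ ∀ b : Fin 9, 2 ∣ ∑ i ∈ z, checkBit L b i + ∑ i ∈ u, checkBit L b i

theorem card_completions_add :
    ∀ L ∈ [checkColumns₁, checkColumns₂],
      (completions L {17, 0, 1}).card + (completions L {17, 0, 3}).card = 5 := by
  decide +kernel


/-- The word `c` passes the nine binary parity checks given by `L`. -/
def Passes (L : List ℕ) (c : Fin 18 → F4) : Prop :=
  ∀ b : Fin 9, ∑ i, (checkBit L b i : F4) * c i = 0

theorem Passes.comp_perm {L : List ℕ} {σ : Equiv.Perm (Fin 18)} (hσ : PreservesRows L σ)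
    {c : Fin 18 → F4} (hc : Passes L c) : Passes L (c ∘ σ) := by
  intro b
  have key : ∀ j, (checkBit L b (σ.symm j) : F4) =
      checkBit L b (σ.symm 17) * checkBit L 8 j + ∑ d : Fin 8,
        ((checkBit L b (σ.symm (d.castLE (by norm_num))) : F4) + checkBit L b (σ.symm 17)) *
          checkBit L d j := by
    intro j
    exact_mod_cast (CharP.natCast_eq_natCast F4 2).2 (hσ b j)
  have h8 : ∑ i, (checkBit L 8 i : F4) * c i = 0 := hc 8
  have hd : ∀ d : Fin 8, ∑ i, (checkBit L d i : F4) * c i = 0 := fun d => hc d.castSucc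
  calc ∑ i, (checkBit L b i : F4) * (c ∘ σ) i
      = ∑ j, (checkBit L b (σ.symm j) : F4) * c j := by
        simp [← Equiv.sum_comp σ fun j => (checkBit L b (σ.symm j) : F4) * c j]
    _ = checkBit L b (σ.symm 17) * ∑ j, (checkBit L 8 j : F4) * c j + ∑ d : Fin 8,
        ((checkBit L b (σ.symm (d.castLE (by norm_num))) : F4) + checkBit L b (σ.symm 17)) *
          ∑ j, (checkBit L d j : F4) * c j := by
        rw [Finset.sum_congr rfl fun j _ => congrArg (· * c j) (key j)]
        simp_rw [add_mul _ _ (c _), Finset.sum_add_distrib, Finset.sum_mul, Finset.mul_sum,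
          mul_assoc]
        rw [Finset.sum_comm]
    _ = 0 := by
        simp only [hd, h8, mul_zero, Finset.sum_const_zero, add_zero]

theorem passes_indicator_iff {L : List ℕ} (s : Finset (Fin 18)) :
    Passes L (fun i => if i ∈ s then 1 else 0) ↔ ∀ b : Fin 9, 2 ∣ ∑ i ∈ s, checkBit L b i := by
  refine forall_congr' fun b => ?_
  rw [← CharP.cast_eq_zero_iff F4 2]
  simp

theorem isSquare_zmod_seventeen :
    ∀ ℓ : ZMod 17, ℓ ≠ 0 ∧ IsSquare ℓ ↔ ∃ k : Fin 8, ℓ.val = 2 ^ (k : ℕ) % 17 := by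
  unfold IsSquare
  decide +kernel

theorem injective_conjugates {K : Type} [Field K] {α : K}
    (hα : IsPrimitiveRoot α 17) :
    Function.Injective fun k : Fin 8 => α ^ 2 ^ (k : ℕ) := by
  intro j k h
  have hmod : ∀ n, α ^ (n % 17) = α ^ n := fun n => by
    rw [hα.eq_orderOf, pow_mod_orderOf]
  simp only [← hmod (2 ^ (_ : ℕ))] at h
  have := hα.pow_inj (Nat.mod_lt _ (by norm_num)) (Nat.mod_lt _ (by norm_num)) h
  clear h hmod
  revert j k
  decide

section Code

variable {K : Type} [Field K] [Algebra F4 K] {α : K}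

theorem qr4Mem_iff_s17 (hα : IsPrimitiveRoot α 17) (c : Fin 17 → F4) :
    qr4Mem α c ↔
      ∀ k : Fin 8, ∑ i : Fin 17, algebraMap F4 K (c i) * (α ^ 2 ^ (k : ℕ)) ^ (i : ℕ) = 0 := by
  have hmod : ∀ n, α ^ (n % 17) = α ^ n := fun n => by
    rw [hα.eq_orderOf, pow_mod_orderOf]
  constructor
  · intro h k
    obtain ⟨h0, hs⟩ := (isSquare_zmod_seventeen ((2 ^ (k : ℕ) : ℕ) : ZMod 17)).2
      ⟨k, ZMod.val_natCast 17 _⟩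
    have := h _ h0 hs
    simpa only [ZMod.val_natCast, pow_mul, hmod] using this
  · intro h ℓ h0 hs
    obtain ⟨k, hk⟩ := (isSquare_zmod_seventeen ℓ).1 ⟨h0, hs⟩
    simpa only [hk, pow_mul, hmod] using h k

theorem extQR4Mem_iff_passes (hα : IsPrimitiveRoot α 17) {L : List ℕ}
    (hparity : ∀ i, checkBit L 8 i = 1) (hlast : ∀ b : Fin 8, checkBit L b 17 = 0)
    (hroot : ∀ k : Fin 8, ∀ i : Fin 17, (α ^ 2 ^ (k : ℕ)) ^ (i : ℕ) =
      ∑ b : Fin 8, (checkBit L b i.castSucc : K) * (α ^ 2 ^ (k : ℕ)) ^ (b : ℕ))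
    (c : Fin 18 → F4) : extQR4Mem α c ↔ Passes L c := by
  have hchar : c (Fin.last 17) = - ∑ i : Fin 17, c i.castSucc ↔
      ∑ i, (checkBit L 8 i : F4) * c i = 0 := by
    simp [hparity, Fin.sum_univ_castSucc (n := 17), eq_neg_iff_add_eq_zero, add_comm]
  have hsum : ∀ k : Fin 8,
      ∑ i : Fin 17, algebraMap F4 K (c i.castSucc) * (α ^ 2 ^ (k : ℕ)) ^ (i : ℕ) =
      ∑ b : Fin 8, (algebraMap F4 K (∑ i, (checkBit L b i : F4) * c i)) *
        (α ^ 2 ^ (k : ℕ)) ^ (b : ℕ) := by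
    intro k
    simp_rw [hroot k, Fin.sum_univ_castSucc (n := 17)]
    simp only [show Fin.last 17 = 17 from rfl, hlast, Nat.cast_zero, zero_mul, add_zero, map_sum,
      map_mul, map_natCast, Finset.mul_sum, Finset.sum_mul]
    rw [Finset.sum_comm]
    refine Finset.sum_congr rfl fun _ _ => Finset.sum_congr rfl fun _ _ => by ring
  have hpass : Passes L c ↔ (∀ b : Fin 8, ∑ i, (checkBit L b i : F4) * c i = 0) ∧
      ∑ i, (checkBit L 8 i : F4) * c i = 0 := Fin.forall_fin_succ' (n := 8)
  rw [extQR4Mem, hchar, hpass, qr4Mem_iff_s17 hα]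
  refine and_congr_left fun _ => ?_
  simp_rw [hsum]
  constructor
  · intro h b
    have := congrFun
      (Matrix.eq_zero_of_forall_index_sum_mul_pow_eq_zero (injective_conjugates hα) h) b
    exact (map_eq_zero _).1 this
  · intro h k
    simp [h]

theorem exists_passes_iff (hα : IsPrimitiveRoot α 17) :
    ∃ L ∈ [checkColumns₁, checkColumns₂], ∀ c, extQR4Mem α c ↔ Passes L c := by
  have : CharP K 2 := charP_of_injective_algebraMap (algebraMap F4 K).injective 2
  have htwo : (2 : K) = 0 := CharTwo.two_eq_zero
  have hfac : (α ^ 8 + α ^ 5 + α ^ 4 + α ^ 3 + 1) *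
      (α ^ 8 + α ^ 7 + α ^ 6 + α ^ 4 + α ^ 2 + α + 1) = 0 := by
    refine (mul_eq_zero.1 ?_).resolve_left (sub_ne_zero.2 (hα.ne_one (by norm_num)))
    have := hα.pow_eq_one
    grind
  rcases mul_eq_zero.1 hfac with h | h
  · refine ⟨checkColumns₁, by simp, extQR4Mem_iff_passes hα (by decide) (by decide) ?_⟩
    intro k
    have hk : (α ^ 2 ^ (k : ℕ)) ^ 8 + (α ^ 2 ^ (k : ℕ)) ^ 5 + (α ^ 2 ^ (k : ℕ)) ^ 4 +
        (α ^ 2 ^ (k : ℕ)) ^ 3 + 1 = 0 := by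
      have := congrArg (· ^ 2 ^ (k : ℕ)) h
      simpa [add_pow_char_pow, ← pow_mul, mul_comm] using this
    generalize α ^ 2 ^ (k : ℕ) = β at hk
    intro i
    fin_cases i <;> simp [Fin.sum_univ_succ, checkBit, checkColumns₁] <;> grind
  · refine ⟨checkColumns₂, by simp, extQR4Mem_iff_passes hα (by decide) (by decide) ?_⟩
    intro k
    have hk : (α ^ 2 ^ (k : ℕ)) ^ 8 + (α ^ 2 ^ (k : ℕ)) ^ 7 + (α ^ 2 ^ (k : ℕ)) ^ 6 +
        (α ^ 2 ^ (k : ℕ)) ^ 4 + (α ^ 2 ^ (k : ℕ)) ^ 2 + α ^ 2 ^ (k : ℕ) + 1 = 0 := by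
      have := congrArg (· ^ 2 ^ (k : ℕ)) h
      simpa [add_pow_char_pow, ← pow_mul, mul_comm] using this
    generalize α ^ 2 ^ (k : ℕ) = β at hk
    intro i
    fin_cases i <;> simp [Fin.sum_univ_succ, checkBit, checkColumns₂] <;> grind

end Code

/-- The coordinate permutations preserving the set of words satisfying `P`, as a subgroup. -/
def wordAut {n : ℕ} {F : Type} (P : (Fin n → F) → Prop) : Subgroup (Equiv.Perm (Fin n)) where
  carrier := {σ | ∀ c, P c → P (c ∘ σ)}
  mul_mem' {σ τ} hσ hτ c hc := hτ (c ∘ σ) (hσ c hc)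
  one_mem' _ hc := hc
  inv_mem' {σ} hσ := by
    have hpow : ∀ k : ℕ, ∀ c, P c → P (c ∘ (σ ^ k : Equiv.Perm (Fin n))) := by
      intro k
      induction k with
      | zero => simp
      | succ k ih =>
        intro c hc
        rw [pow_succ]
        exact hσ _ (ih c hc)
    have hinv : σ⁻¹ = σ ^ (orderOf σ - 1) := by
      rw [inv_eq_iff_mul_eq_one, ← pow_succ', Nat.sub_add_cancel (orderOf_pos σ), pow_orderOf_eq_one]
    rw [hinv]
    exact hpow _

theorem mem_wordAut {n : ℕ} {F : Type} {P : (Fin n → F) → Prop} {σ : Equiv.Perm (Fin n)} :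
    σ ∈ wordAut P ↔ ∀ c, P c → P (c ∘ σ) := Iff.rfl

theorem card_completions_le {L : List ℕ} {σ : Equiv.Perm (Fin 18)} (hσ : σ ∈ wordAut (Passes L))
    (z : Finset (Fin 18)) :
    (completions L z).card ≤ (completions L (z.image ⇑σ⁻¹)).card := by
  refine Finset.card_le_card_of_injOn (Finset.image ⇑σ⁻¹) ?_
    (Finset.image_injective σ⁻¹.injective).injOn
  intro u hu
  simp only [completions, Finset.coe_filter, Finset.mem_powersetCard_univ, Set.mem_ofPred_eq]
    at hu ⊢
  obtain ⟨hcard, hdisj, hsum⟩ := hu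
  have hdisj' := (Finset.disjoint_image σ⁻¹.injective).2 hdisj
  refine ⟨by rw [Finset.card_image_of_injective _ σ⁻¹.injective, hcard], hdisj', ?_⟩
  simp_rw [← Finset.sum_union hdisj] at hsum
  simp_rw [← Finset.sum_union hdisj', ← Finset.image_union]
  rw [← passes_indicator_iff] at hsum ⊢
  convert mem_wordAut.1 hσ _ hsum using 1
  ext i
  simp [Equiv.symm_apply_eq]

theorem card_completions_image {L : List ℕ} {σ : Equiv.Perm (Fin 18)} (hσ : σ ∈ wordAut (Passes L))
    (z : Finset (Fin 18)) :
    (completions L (z.image ⇑σ⁻¹)).card = (completions L z).card := by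
  refine le_antisymm ?_ (card_completions_le hσ z)
  have := card_completions_le (inv_mem hσ) (z.image ⇑σ⁻¹)
  simpa [Finset.image_image] using this

theorem exists_translation_eq_zero :
    ∀ i : Fin 18, i ≠ 17 → ∃ k, translation k i = 0 := by
  decide

theorem translation_infinity : ∀ k, translation k 17 = 17 := by
  decide

theorem homothety_infinity : ∀ k, homothety k 17 = 17 := by
  decide

theorem homothety_zero : ∀ k, homothety k 0 = 0 := by
  decide

theorem exists_homothety_eq :
    ∀ i : Fin 18, i ≠ 17 → i ≠ 0 → ∃ k, homothety k 1 = i ∨ homothety k 3 = i := by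
  decide

section Action

variable {G : Subgroup (Equiv.Perm (Fin 18))}

/-- `G` contains generators of the group of the projective line over `𝔽₁₇`. -/
structure ContainsPSL (G : Subgroup (Equiv.Perm (Fin 18))) : Prop where
  translation_mem : ∀ k, translation k ∈ G
  homothety_mem : ∀ k, homothety k ∈ G
  inversion_mem : inversion ∈ G

theorem containsPSL_wordAut {L : List ℕ} (hL : L ∈ [checkColumns₁, checkColumns₂]) :
    ContainsPSL (wordAut (Passes L)) where
  translation_mem k := mem_wordAut.2 fun _ hc => hc.comp_perm (preservesRows_translation L hL k)
  homothety_mem k := mem_wordAut.2 fun _ hc => hc.comp_perm (preservesRows_homothety L hL k)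
  inversion_mem := mem_wordAut.2 fun _ hc => hc.comp_perm (preservesRows_inversion L hL)

theorem ContainsPSL.exists_map_pair (hG : ContainsPSL G) {a b : Fin 18} (hab : a ≠ b) :
    ∃ σ ∈ G, σ a = 17 ∧ σ b = 0 := by
  have hinf : ∀ b : Fin 18, b ≠ 17 → ∃ σ ∈ G, σ 17 = 17 ∧ σ b = 0 := fun b hb => by
    obtain ⟨k, hk⟩ := exists_translation_eq_zero b hb
    exact ⟨_, hG.translation_mem k, translation_infinity k, hk⟩
  by_cases ha : a = 17
  · subst ha
    exact hinf b hab.symm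
  · obtain ⟨k, hk⟩ := exists_translation_eq_zero a ha
    have hmove : (inversion * translation k) a = 17 := by
      rw [Equiv.Perm.mul_apply, hk]; decide
    obtain ⟨σ, hσ, h17, h0⟩ := hinf ((inversion * translation k) b)
      (fun h => hab ((inversion * translation k).injective (hmove.trans h.symm)))
    refine ⟨σ * (inversion * translation k),
      mul_mem hσ (mul_mem hG.inversion_mem (hG.translation_mem k)), ?_, h0⟩
    rw [Equiv.Perm.mul_apply, hmove, h17]

variable {g : Fin 18 → Fin 18 → Fin 18 → ℝ}

theorem ContainsPSL.eq_of_ne (hG : ContainsPSL G)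
    (hg : ∀ σ ∈ G, ∀ a b c, g (σ a) (σ b) (σ c) = g a b c) {i : Fin 18}
    (h17 : i ≠ 17) (h0 : i ≠ 0) : g 17 0 i = g 17 0 1 ∨ g 17 0 i = g 17 0 3 := by
  obtain ⟨k, rfl | rfl⟩ := exists_homothety_eq i h17 h0
  · left
    simpa [homothety_infinity, homothety_zero] using hg _ (hG.homothety_mem k) 17 0 1
  · right
    simpa [homothety_infinity, homothety_zero] using hg _ (hG.homothety_mem k) 17 0 3

theorem ContainsPSL.eq_or_eq (hG : ContainsPSL G)
    (hg : ∀ σ ∈ G, ∀ a b c, g (σ a) (σ b) (σ c) = g a b c) {a b c : Fin 18}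
    (hab : a ≠ b) (hac : a ≠ c) (hbc : b ≠ c) : g a b c = g 17 0 1 ∨ g a b c = g 17 0 3 := by
  obtain ⟨σ, hσ, ha, hb⟩ := hG.exists_map_pair hab
  rw [← hg σ hσ, ha, hb]
  exact hG.eq_of_ne hg (fun h => hac (σ.injective (ha.trans h.symm)))
    (fun h => hbc (σ.injective (hb.trans h.symm)))

theorem ContainsPSL.sum_eq (hG : ContainsPSL G)
    (hg : ∀ σ ∈ G, ∀ a b c, g (σ a) (σ b) (σ c) = g a b c)
    (hdeg : ∀ a b, g a b a = 0 ∧ g a b b = 0) {a b : Fin 18} (hab : a ≠ b) :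
    ∑ c, g a b c = 8 * (g 17 0 1 + g 17 0 3) := by
  obtain ⟨σ, hσ, ha, hb⟩ := hG.exists_map_pair hab
  have h1 : ∀ k, g 17 0 (homothety k 1) = g 17 0 1 := fun k => by
    simpa [homothety_infinity, homothety_zero] using hg _ (hG.homothety_mem k) 17 0 1
  have h3 : ∀ k, g 17 0 (homothety k 3) = g 17 0 3 := fun k => by
    simpa [homothety_infinity, homothety_zero] using hg _ (hG.homothety_mem k) 17 0 3
  have huniv : (Finset.univ : Finset (Fin 18)) = {17, 0} ∪
      (Finset.univ.image (fun k => homothety k 1) ∪ Finset.univ.image fun k => homothety k 3) := by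
    decide
  calc ∑ c, g a b c = ∑ c, g 17 0 (σ c) := by simp_rw [← ha, ← hb, hg σ hσ]
    _ = ∑ c, g 17 0 c := Equiv.sum_comp σ _
    _ = 8 * (g 17 0 1 + g 17 0 3) := by
      rw [huniv, Finset.sum_union (by decide), Finset.sum_union (by decide),
        Finset.sum_image (by decide), Finset.sum_image (by decide),
        Finset.sum_pair (by decide), (hdeg 17 0).1, (hdeg 17 0).2]
      simp [h1, h3, mul_add]

end Action

/-- The function on ordered triples underlying a function on `3`-subsets, extended by zero. -/
def ordered {n : ℕ} (f : {s : Finset (Fin n) // s.card = 3} → ℝ) (a b c : Fin n) : ℝ :=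
  if h : ({a, b, c} : Finset (Fin n)).card = 3 then f ⟨_, h⟩ else 0

theorem ordered_smul_sub {n : ℕ} (r : ℝ) (f w : {s : Finset (Fin n) // s.card = 3} → ℝ)
    (a b c : Fin n) : ordered (r • f - w) a b c = r * ordered f a b c - ordered w a b c := by
  unfold ordered
  split_ifs <;> simp

theorem ordered_perm {n : ℕ} {f : {s : Finset (Fin n) // s.card = 3} → ℝ}
    {σ : Equiv.Perm (Fin n)} (hf : ∀ z, f (permX3 σ⁻¹ z) = f z) (a b c : Fin n) :
    ordered f (σ a) (σ b) (σ c) = ordered f a b c := by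
  have himage : ({σ a, σ b, σ c} : Finset (Fin n)) = Finset.image σ {a, b, c} := by
    simp [Finset.image_insert]
  have hcard : ({σ a, σ b, σ c} : Finset (Fin n)).card = ({a, b, c} : Finset (Fin n)).card := by
    rw [himage, Finset.card_image_of_injective _ σ.injective]
  unfold ordered
  by_cases h : ({a, b, c} : Finset (Fin n)).card = 3
  · rw [dif_pos h, dif_pos (hcard.trans h), ← hf]
    congr 1
    simp [permX3, Finset.image_insert]
  · rw [dif_neg h, dif_neg (hcard ▸ h)]

theorem ordered_degenerate {n : ℕ} (f : {s : Finset (Fin n) // s.card = 3} → ℝ) (a b : Fin n) :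
    ordered f a b a = 0 ∧ ordered f a b b = 0 := by
  have h : ({a, b} : Finset (Fin n)).card ≤ 2 := Finset.card_le_two
  constructor
  · refine dif_neg fun h3 => ?_
    rw [show ({a, b, a} : Finset (Fin n)) = {a, b} by ext; simp; tauto] at h3
    omega
  · refine dif_neg fun h3 => ?_
    rw [show ({a, b, b} : Finset (Fin n)) = {a, b} by simp] at h3
    omega

theorem gammaLin_apply_pair {n : ℕ} (f : {s : Finset (Fin n) // s.card = 3} → ℝ) {a b : Fin n}
    (h : ({a, b} : Finset (Fin n)).card = 2) :
    gammaLin n f ⟨{a, b}, h⟩ = ∑ c, ordered f a b c := by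
  have hab : a ≠ b := by
    rintro rfl
    simp at h
  have hins : ∀ c, ({a, b, c} : Finset (Fin n)).card = 3 ↔ c ∉ ({a, b} : Finset (Fin n)) := by
    intro c
    rw [show ({a, b, c} : Finset (Fin n)) = insert c {a, b} by ext; simp; tauto]
    by_cases hc : c ∈ ({a, b} : Finset (Fin n))
    · simp [Finset.insert_eq_of_mem hc, h, hc]
    · simp [Finset.card_insert_of_notMem hc, h, hc]
  simp only [gammaLin, LinearMap.pi_apply, LinearMap.sum_apply, LinearMap.proj_apply]
  have hzero : ∑ c with ¬({a, b, c} : Finset (Fin n)).card = 3, ordered f a b c = 0 :=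
    Finset.sum_eq_zero fun c hc => dif_neg (Finset.mem_filter.1 hc).2
  rw [← Finset.sum_filter_add_sum_filter_not Finset.univ
    (fun c => ({a, b, c} : Finset (Fin n)).card = 3) (ordered f a b), hzero, add_zero]
  symm
  refine Finset.sum_bij (fun c hc => ⟨{a, b, c}, (Finset.mem_filter.1 hc).2⟩) ?_ ?_ ?_ ?_
  · intro c hc
    simp [Finset.insert_subset_iff]
  · intro c hc d hd hcd
    have hc' := (hins c).1 (Finset.mem_filter.1 hc).2
    have : c ∈ ({a, b, d} : Finset (Fin n)) := by
      rw [← Subtype.mk.inj hcd]; simp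
    simp only [Finset.mem_insert, Finset.mem_singleton] at this hc'
    tauto
  · rintro ⟨z, hz⟩ hmem
    have hsub : ({a, b} : Finset (Fin n)) ⊆ z := (Finset.mem_filter.1 hmem).2
    obtain ⟨c, hc⟩ := Finset.card_eq_one.1
      (show (z \ {a, b}).card = 1 by rw [Finset.card_sdiff_of_subset hsub, hz, h])
    have hz' : ({a, b, c} : Finset (Fin n)) = z := by
      rw [← Finset.union_sdiff_of_subset hsub, hc]
      ext; simp
    exact ⟨c, by simp [hz', hz], Subtype.ext hz'⟩
  · intro c hc
    exact dif_pos (Finset.mem_filter.1 hc).2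

theorem mem_harmonic_iff {G : Subgroup (Equiv.Perm (Fin 18))} (hG : ContainsPSL G)
    {f : {s : Finset (Fin 18) // s.card = 3} → ℝ} (hf : ∀ σ ∈ G, ∀ z, f (permX3 σ⁻¹ z) = f z) :
    f ∈ LinearMap.ker (gammaLin 18) ↔ ordered f 17 0 1 + ordered f 17 0 3 = 0 := by
  have hsum : ∀ {a b : Fin 18}, a ≠ b → ∑ c, ordered f a b c =
      8 * (ordered f 17 0 1 + ordered f 17 0 3) :=
    hG.sum_eq (fun σ hσ => ordered_perm (hf σ hσ)) (ordered_degenerate f)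
  rw [LinearMap.mem_ker]
  constructor
  · intro h
    have := congrFun h ⟨{17, 0}, by decide⟩
    rw [gammaLin_apply_pair, hsum (by decide)] at this
    simpa using this
  · intro h
    ext ⟨y, hy⟩
    obtain ⟨a, b, hab, rfl⟩ := Finset.card_eq_two.1 hy
    rw [gammaLin_apply_pair, hsum hab, h]
    simp

theorem eq_zero_of_invariant {G : Subgroup (Equiv.Perm (Fin 18))} (hG : ContainsPSL G)
    {f : {s : Finset (Fin 18) // s.card = 3} → ℝ} (hf : ∀ σ ∈ G, ∀ z, f (permX3 σ⁻¹ z) = f z)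
    (h1 : ordered f 17 0 1 = 0) (h3 : ordered f 17 0 3 = 0) : f = 0 := by
  ext ⟨z, hz⟩
  obtain ⟨a, b, c, hab, hac, hbc, rfl⟩ := Finset.card_eq_three.1 hz
  have := hG.eq_or_eq (fun σ hσ => ordered_perm (hf σ hσ)) hab hac hbc
  rw [h1, h3, or_self] at this
  simpa [ordered, hz] using this

theorem finrank_passes {L : List ℕ} (hL : L ∈ [checkColumns₁, checkColumns₂]) :
    Module.finrank ℝ
      ↥(LinearMap.ker (gammaLin 18) ⊓
        ⨅ σ ∈ {σ : Equiv.Perm (Fin 18) | ∀ c : Fin 18 → F4, Passes L c → Passes L (c ∘ σ)},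
          LinearMap.ker (LinearMap.funLeft ℝ ℝ (permX3 σ⁻¹) - LinearMap.id)) = 1 := by
  have hG := containsPSL_wordAut hL
  have hmem : ∀ f, f ∈ (LinearMap.ker (gammaLin 18) ⊓
        ⨅ σ ∈ {σ : Equiv.Perm (Fin 18) | ∀ c : Fin 18 → F4, Passes L c → Passes L (c ∘ σ)},
          LinearMap.ker (LinearMap.funLeft ℝ ℝ (permX3 σ⁻¹) - LinearMap.id)) ↔
      f ∈ LinearMap.ker (gammaLin 18) ∧ ∀ σ ∈ wordAut (Passes L), ∀ z, f (permX3 σ⁻¹ z) = f z := by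
    intro f
    simp only [Submodule.mem_inf, Submodule.mem_iInf, LinearMap.mem_ker (f := _ - LinearMap.id),
      LinearMap.sub_apply, sub_eq_zero, funext_iff, LinearMap.funLeft_apply, LinearMap.id_apply,
      ← mem_wordAut, Set.mem_ofPred_eq]
  set f₀ : {s : Finset (Fin 18) // s.card = 3} → ℝ :=
    fun z => 2 * (completions L z.1).card - 5 with hf₀
  have hinv₀ : ∀ σ ∈ wordAut (Passes L), ∀ z, f₀ (permX3 σ⁻¹ z) = f₀ z := by
    intro σ hσ z
    simp only [hf₀, permX3, card_completions_image hσ]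
  have hord : ∀ i, ({17, 0, i} : Finset (Fin 18)).card = 3 →
      ordered f₀ 17 0 i = 2 * (completions L {17, 0, i}).card - 5 := fun i h => dif_pos h
  have hne : ordered f₀ 17 0 1 ≠ 0 := by
    rw [hord 1 (by decide), sub_ne_zero]
    norm_cast
    omega
  have hcount : ((completions L {17, 0, 1}).card : ℝ) + (completions L {17, 0, 3}).card = 5 := by
    exact_mod_cast card_completions_add L hL
  have hmem₀ := (hmem f₀).2 ⟨(mem_harmonic_iff hG hinv₀).2 (by
    rw [hord 1 (by decide), hord 3 (by decide)]; linarith), hinv₀⟩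
  refine (finrank_eq_one_iff_of_nonzero' ⟨f₀, hmem₀⟩ fun h => hne ?_).2 ?_
  · rw [show f₀ = 0 from congrArg Subtype.val h]
    simp [ordered]
  · rintro ⟨w, hw⟩
    obtain ⟨hker, hinv⟩ := (hmem w).1 hw
    refine ⟨ordered w 17 0 1 / ordered f₀ 17 0 1, Subtype.ext (sub_eq_zero.1 ?_)⟩
    have hw_add := (mem_harmonic_iff hG hinv).1 hker
    have hf_add := (mem_harmonic_iff hG hinv₀).1 ((hmem f₀).1 hmem₀).1
    refine eq_zero_of_invariant hG (fun σ hσ z => ?_) ?_ ?_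
    · simp [hinv σ hσ z, hinv₀ σ hσ z]
    · rw [Submodule.coe_smul, ordered_smul_sub]
      field_simp
      ring
    · rw [Submodule.coe_smul, ordered_smul_sub, eq_neg_of_add_eq_zero_right hw_add,
        eq_neg_of_add_eq_zero_right hf_add]
      field_simp
      ring

/-- The space `Harm₃^{Aut(C)}` of degree-3 harmonic functions (elements of `ker γ` on
`ℝX₃`) invariant under the automorphism group of the extended quaternary quadratic residue
code `C` of length 18 has dimension 1. -/
theorem quaternary_invariant_harmonic_dim (K : Type) [Field K] [Algebra F4 K] (α : K)
    (hα : IsPrimitiveRoot α 17) :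
    Module.finrank ℝ
      ↥(LinearMap.ker (gammaLin 18) ⊓
        ⨅ σ ∈ {σ : Equiv.Perm (Fin 18) |
            ∀ c : Fin 18 → F4, extQR4Mem α c → extQR4Mem α (c ∘ σ)},
          LinearMap.ker (LinearMap.funLeft ℝ ℝ (permX3 σ⁻¹) - LinearMap.id)) = 1 := by
  obtain ⟨L, hL, hC⟩ := exists_passes_iff hα
  rw [show extQR4Mem α = Passes L from funext fun c => propext (hC c)]
  exact finrank_passes hL
end
end
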